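/- arXiv:2506.00610 — 5 statements merged into one kernel-verified Lean document; each statement's English description precedes it below -/
import Mathlib

section
/- Let G be an abelian group (written multiplicatively). The sequence of abelian groups ℤ(G×G×G) →∂₃ F_G →∂₂ ℤG →∂₁ G → 0, where ∂₁(Σ_g n_g·g) = Π_g g^{n_g}, ∂₂({g,h}) = g + h − gh, and ∂₃((g,h,k)) = {h,k}{g,hk}{g,h}^{-1}{gh,k}^{-1}, is exact: ∂₁ is surjective, ker ∂₁ = im ∂₂, and ker ∂₂ = im ∂₃. In particular, ker ∂₂ = ⟨R_G⟩, so F_G, ℤ(G×G×G) and ℤG give a free resolution of G. -/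
/-!
STATEMENT 5: The sequence `ℤ(G×G×G) →∂₃ F_G →∂₂ ℤG →∂₁ G → 0` with
`∂₁(Σ n_g·g) = Π g^{n_g}`, `∂₂({g,h}) = g + h − gh`,
`∂₃((g,h,k)) = {h,k}{g,hk}{g,h}⁻¹{gh,k}⁻¹` is exact; in particular `ker ∂₂ = ⟨R_G⟩`,
so these groups give a free resolution of `G`.
(`F_G` and `⟨R_G⟩` are written additively; the additive group of `ℤG` is `G →₀ ℤ`
and the free abelian group `ℤ(G×G×G)` is `FreeAbelianGroup (G × G × G)`;
the target `G` is written additively as `Additive G`.)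
-/

universe u

open FreeAbelianGroup

variable (G : Type u) [CommGroup G]

/-- The set of relators `{g,h}{gh,k}{h,k}⁻¹{g,hk}⁻¹` (written additively)
in the free abelian group `F_G` on the set of unordered pairs of elements of `G`. -/
def relatorSet : Set (FreeAbelianGroup (Sym2 G)) :=
  {r | ∃ g h k : G,
    r = of s(g, h) + of s(g * h, k) - of s(h, k) - of s(g, h * k)}

/-- The subgroup `⟨R_G⟩` of `F_G` generated by the relators. -/
def RG : AddSubgroup (FreeAbelianGroup (Sym2 G)) :=
  AddSubgroup.closure (relatorSet G)

/-- `∂₁ : ℤG → G`, `Σ n_g·g ↦ Π g^{n_g}`. -/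
noncomputable def d1 : (G →₀ ℤ) →+ Additive G :=
  Finsupp.liftAddHom fun g => zmultiplesHom (Additive G) (Additive.ofMul g)

/-- `∂₂ : F_G → ℤG`, `{g,h} ↦ g + h − gh`. -/
noncomputable def d2 : FreeAbelianGroup (Sym2 G) →+ (G →₀ ℤ) :=
  FreeAbelianGroup.lift (Sym2.lift
    ⟨fun g h => Finsupp.single g 1 + Finsupp.single h 1 - Finsupp.single (g * h) 1,
      fun g h => by dsimp only; rw [mul_comm h g]; abel⟩)

/-- `∂₃ : ℤ(G×G×G) → F_G`, `(g,h,k) ↦ {h,k} + {g,hk} − {g,h} − {gh,k}`. -/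
noncomputable def d3 : FreeAbelianGroup (G × G × G) →+ FreeAbelianGroup (Sym2 G) :=
  FreeAbelianGroup.lift fun t =>
    of s(t.2.1, t.2.2) + of s(t.1, t.2.1 * t.2.2) - of s(t.1, t.2.1) - of s(t.1 * t.2.1, t.2.2)

/-- A symmetric 2-cocycle on a commutative group with values in a trivial module. -/
structure SymmCocycle (A : Type*) [AddCommGroup A] where
  /-- The underlying function. -/
  toFun : G → G → A
  symm : ∀ g h, toFun g h = toFun h g
  cocycle : ∀ g h k, toFun g h + toFun (g * h) k = toFun h k + toFun g (h * k)

namespace SymmCocycle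

variable {G} {A : Type*} [AddCommGroup A]

theorem one_left (c : SymmCocycle G A) (g : G) : c.toFun 1 g = c.toFun 1 1 := by
  have h := c.cocycle 1 1 g
  simp only [one_mul] at h
  exact (add_right_cancel h).symm

/-- The extension of `G` by `A` determined by a symmetric 2-cocycle. -/
@[ext]
structure Extension (c : SymmCocycle G A) where
  /-- The component in the kernel. -/
  fst : A
  /-- The component in the quotient. -/
  snd : G

namespace Extension

variable {c : SymmCocycle G A}

instance : Add c.Extension := ⟨fun x y => ⟨x.fst + y.fst + c.toFun x.snd y.snd, x.snd * y.snd⟩⟩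

instance : Zero c.Extension := ⟨⟨-c.toFun 1 1, 1⟩⟩

instance : Neg c.Extension :=
  ⟨fun x => ⟨-x.fst - c.toFun x.snd⁻¹ x.snd - c.toFun 1 1, x.snd⁻¹⟩⟩

@[simp] theorem add_fst (x y : c.Extension) :
    (x + y).fst = x.fst + y.fst + c.toFun x.snd y.snd := rfl

@[simp] theorem add_snd (x y : c.Extension) : (x + y).snd = x.snd * y.snd := rfl

@[simp] theorem zero_fst : (0 : c.Extension).fst = -c.toFun 1 1 := rfl

@[simp] theorem zero_snd : (0 : c.Extension).snd = 1 := rfl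

@[simp] theorem neg_fst (x : c.Extension) :
    (-x).fst = -x.fst - c.toFun x.snd⁻¹ x.snd - c.toFun 1 1 := rfl

@[simp] theorem neg_snd (x : c.Extension) : (-x).snd = x.snd⁻¹ := rfl

instance : AddCommGroup c.Extension :=
  { AddGroup.ofLeftAxioms (G := c.Extension)
      (fun x y z => by
        ext
        · have h := c.cocycle x.snd y.snd z.snd
          simp only [add_fst, add_snd]
          rw [← sub_eq_zero] at h ⊢
          rw [← h]
          abel
        · simp [mul_assoc])
      (fun x => by
        ext
        · simp [c.one_left]
        · simp)
      (fun x => by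
        ext
        · simp only [add_fst, neg_fst, neg_snd, zero_fst]
          abel
        · simp) with
    add_comm := fun x y => by
      ext
      · simp only [add_fst, c.symm x.snd, add_comm x.fst]
      · simp [mul_comm] }

variable (c)

/-- The inclusion of the kernel in the extension. -/
def inl : A →+ c.Extension where
  toFun a := ⟨a - c.toFun 1 1, 1⟩
  map_zero' := by ext <;> simp
  map_add' a b := by
    ext
    · simp only [add_fst]
      abel
    · simp

theorem inl_injective : Function.Injective (inl c) := fun _ _ h =>
  sub_left_injective (congrArg Extension.fst h)

theorem inl_toFun_add (g h : G) :
    inl c (c.toFun g h) + ⟨0, g * h⟩ = (⟨0, g⟩ + ⟨0, h⟩ : c.Extension) := by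
  ext
  · simp [inl, c.one_left]
  · simp [inl]

end Extension

end SymmCocycle

@[simp] theorem d1_single (g : G) (n : ℤ) :
    d1 G (Finsupp.single g n) = n • Additive.ofMul g := by
  simp [d1]

@[simp] theorem d2_of (g h : G) : d2 G (of s(g, h)) =
    Finsupp.single g 1 + Finsupp.single h 1 - Finsupp.single (g * h) 1 := by
  simp [d2]

@[simp] theorem d3_of (g h k : G) : d3 G (of (g, h, k)) =
    of s(h, k) + of s(g, h * k) - of s(g, h) - of s(g * h, k) := by
  simp [d3]

theorem d1_surjective : Function.Surjective (d1 G) := fun g =>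
  ⟨Finsupp.single g.toMul 1, by simp⟩

theorem d1_comp_d2 : (d1 G).comp (d2 G) = 0 := by
  ext p
  induction p with | _ g h => simp

/-- The homomorphism from `G` to the cokernel of `∂₂` sending `g` to the class of `g`. -/
noncomputable def toCokerD2 : Additive G →+ (G →₀ ℤ) ⧸ (d2 G).range :=
  AddMonoidHom.mk' (fun g => QuotientAddGroup.mk (Finsupp.single g.toMul 1)) fun g h => by
    rw [← QuotientAddGroup.mk_add, eq_comm, QuotientAddGroup.eq_iff_sub_mem]
    exact ⟨of s(g.toMul, h.toMul), d2_of G _ _⟩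

theorem toCokerD2_comp_d1 :
    (toCokerD2 G).comp (d1 G) = QuotientAddGroup.mk' (d2 G).range := by
  ext g
  simp [toCokerD2]

theorem ker_d1 : (d1 G).ker = (d2 G).range := by
  refine le_antisymm (fun x hx => ?_) ?_
  · rw [← QuotientAddGroup.eq_zero_iff, ← QuotientAddGroup.mk'_apply, ← toCokerD2_comp_d1,
      AddMonoidHom.comp_apply, hx, map_zero]
  · rintro _ ⟨x, rfl⟩
    exact DFunLike.congr_fun (d1_comp_d2 G) x

theorem range_d3 : (d3 G).range = RG G := by
  refine le_antisymm ?_ ?_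
  · rintro _ ⟨x, rfl⟩
    induction x using FreeAbelianGroup.induction_on with
    | zero => simp
    | of t =>
      rw [d3_of, ← neg_mem_iff]
      exact AddSubgroup.subset_closure ⟨t.1, t.2.1, t.2.2, by abel⟩
    | neg t ih => simpa using ih
    | add x y hx hy => simpa using add_mem hx hy
  · refine (AddSubgroup.closure_le _).2 ?_
    rintro _ ⟨g, h, k, rfl⟩
    refine ⟨-of (g, h, k), ?_⟩
    rw [map_neg, d3_of]
    abel

theorem RG_le_ker_d2 : RG G ≤ (d2 G).ker := by
  refine (AddSubgroup.closure_le _).2 ?_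
  rintro _ ⟨g, h, k, rfl⟩
  simp only [SetLike.mem_coe, AddMonoidHom.mem_ker, map_sub, map_add, d2_of, mul_assoc]
  abel

/-- The universal symmetric 2-cocycle, with values in `F_G / ⟨R_G⟩`. -/
def universalCocycle : SymmCocycle G (FreeAbelianGroup (Sym2 G) ⧸ RG G) where
  toFun g h := QuotientAddGroup.mk (of s(g, h))
  symm g h := by rw [Sym2.eq_swap]
  cocycle g h k := by
    rw [← QuotientAddGroup.mk_add, ← QuotientAddGroup.mk_add, QuotientAddGroup.eq_iff_sub_mem,
      ← sub_sub]
    exact AddSubgroup.subset_closure ⟨g, h, k, rfl⟩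

/-- The homomorphism from `ℤG` to the universal extension that extends its canonical section. -/
noncomputable def toUniversalExtension : (G →₀ ℤ) →+ (universalCocycle G).Extension :=
  Finsupp.liftAddHom fun g => zmultiplesHom _ ⟨0, g⟩

theorem toUniversalExtension_single_one (g : G) :
    toUniversalExtension G (Finsupp.single g 1) = ⟨0, g⟩ := by
  simp [toUniversalExtension]

theorem toUniversalExtension_comp_d2 : (toUniversalExtension G).comp (d2 G) =
    (SymmCocycle.Extension.inl (universalCocycle G)).comp (QuotientAddGroup.mk' (RG G)) := by
  ext p : 1
  induction p with | _ g h =>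
  rw [AddMonoidHom.comp_apply, d2_of, map_sub, map_add, sub_eq_iff_eq_add]
  simp only [toUniversalExtension_single_one]
  exact (SymmCocycle.Extension.inl_toFun_add (universalCocycle G) g h).symm

theorem ker_d2 : (d2 G).ker = RG G := by
  refine le_antisymm (fun x hx => ?_) (RG_le_ker_d2 G)
  have h := DFunLike.congr_fun (toUniversalExtension_comp_d2 G) x
  rw [AddMonoidHom.comp_apply, hx, map_zero, AddMonoidHom.comp_apply, eq_comm,
    map_eq_zero_iff _ (SymmCocycle.Extension.inl_injective _)] at h
  exact (QuotientAddGroup.eq_zero_iff x).1 h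

theorem freeResolution_exact :
    Function.Surjective (d1 G) ∧
    (d1 G).ker = (d2 G).range ∧
    (d2 G).ker = (d3 G).range ∧
    (d2 G).ker = RG G :=
  ⟨d1_surjective G, ker_d1 G, (ker_d2 G).trans (range_d3 G).symm, ker_d2 G⟩
end

section
/- Let G be a finite abelian group of order N and F an algebraically closed field. Let X ⊆ F^{P_G} be the set of generic G-graded contractions, i.e., tuples x = (x_{{g,h}}) satisfying x_{{g,h}}x_{{gh,k}} = x_{{h,k}}x_{{g,hk}} for all g,h,k ∈ G, and let the torus T_G = (F^×)^G act on F^{P_G} by (α·x)_{{g,h}} = α(g)α(h)α(gh)^{-1}·x_{{g,h}}. Then the Zariski closure X(1̄) of the T_G-orbit of the all-ones tuple 1̄ is the unique irreducible component of X containing 1̄, and X(1̄) has dimension N. -/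
/-!
STATEMENT 11: For a finite abelian group `G` of order `N` and an algebraically closed
field `F`, the Zariski closure `X(1̄)` of the `T_G`-orbit of the all-ones tuple in the
variety `X ⊆ F^{P_G}` of generic graded contractions is the unique irreducible component
of `X` containing `1̄`, and `X(1̄)` has dimension `N`.
-/

universe u v

variable (G : Type u) [CommGroup G] (F : Type v) [Field F]

/-- The Zariski topology on the affine space `F^{P_G}`: closed sets are the common zero
sets of families of polynomials in the variables indexed by `P_G = Sym2 G`. -/
noncomputable instance zariskiTopology : TopologicalSpace (Sym2 G → F) :=
  TopologicalSpace.ofClosed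
    {C | ∃ P : Set (MvPolynomial (Sym2 G) F),
      C = {x | ∀ p ∈ P, MvPolynomial.eval x p = 0}}
    ⟨{1}, by ext x; simp⟩
    (fun A hA => by
      choose P hP using fun C (hC : C ∈ A) => hA hC
      refine ⟨⋃ (C) (hC : C ∈ A), P C hC, ?_⟩
      ext x
      simp only [Set.mem_sInter, Set.mem_setOf_eq, Set.mem_iUnion]
      constructor
      · rintro hx p ⟨C, hC, hp⟩
        have h := hx C hC
        rw [hP C hC] at h
        exact h p hp
      · intro hx C hC
        rw [hP C hC]
        exact fun p hp => hx p ⟨C, hC, hp⟩)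
    (fun A hA B hB => by
      obtain ⟨PA, rfl⟩ := hA
      obtain ⟨PB, rfl⟩ := hB
      refine ⟨{r | ∃ p ∈ PA, ∃ q ∈ PB, r = p * q}, ?_⟩
      ext x
      simp only [Set.mem_union, Set.mem_setOf_eq]
      constructor
      · rintro (hx | hx) r ⟨p, hp, q, hq, rfl⟩ <;> rw [map_mul]
        · rw [hx p hp, zero_mul]
        · rw [hx q hq, mul_zero]
      · intro hx
        by_contra hc
        push_neg at hc
        obtain ⟨⟨p, hp, hpx⟩, ⟨q, hq, hqx⟩⟩ := hc
        have h := hx (p * q) ⟨p, hp, q, hq, rfl⟩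
        rw [map_mul] at h
        rcases mul_eq_zero.mp h with h' | h'
        exacts [hpx h', hqx h'])

/-- The variety `X` of generic `G`-graded contractions: tuples
`x = (x_{{g,h}})_{{g,h} ∈ P_G}` with `x_{{g,h}}·x_{{gh,k}} = x_{{h,k}}·x_{{g,hk}}`. -/
def contractionVariety : Set (Sym2 G → F) :=
  {x | ∀ g h k : G, x s(g, h) * x s(g * h, k) = x s(h, k) * x s(g, h * k)}

/-- The value of the coboundary `dα` at an unordered pair:
`dα({g,h}) = α(g)·α(h)·α(gh)⁻¹`. -/
noncomputable def dal (α : G → Fˣ) : Sym2 G → F :=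
  Sym2.lift ⟨fun g h => ((α g * α h * (α (g * h))⁻¹ : Fˣ) : F),
    fun g h => by dsimp only; rw [mul_comm h g, mul_comm (α h) (α g)]⟩

/-- The `T_G`-orbit of the all-ones tuple `1̄` under the action
`(α·x)_{{g,h}} = dα(g,h)·x_{{g,h}}` of the torus `T_G = (F^×)^G`. -/
noncomputable def onesOrbit : Set (Sym2 G → F) :=
  {x | ∃ α : G → Fˣ, x = dal G F α}

section ZariskiTopology

open MvPolynomial TopologicalSpace

variable {G : Type u} {F : Type v} [Field F]

theorem isClosed_iff_exists_forall_eval_eq_zero {C : Set (Sym2 G → F)} :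
    IsClosed C ↔ ∃ P : Set (MvPolynomial (Sym2 G) F), C = {x | ∀ p ∈ P, eval x p = 0} := by
  rw [← isOpen_compl_iff]
  change Cᶜᶜ ∈ _ ↔ _
  rw [compl_compl]
  rfl

theorem isClosed_zeroLocus (I : Ideal (MvPolynomial (Sym2 G) F)) :
    IsClosed (zeroLocus F I : Set (Sym2 G → F)) :=
  isClosed_iff_exists_forall_eval_eq_zero.2 ⟨I, by ext; simp⟩

theorem isOpen_setOf_forall_ne_zero [Finite G] : IsOpen {x : Sym2 G → F | ∀ i, x i ≠ 0} := by
  have : {x : Sym2 G → F | ∀ i, x i ≠ 0} = ⋂ i, {x | x i ≠ 0} := by ext; simp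
  rw [this]
  refine isOpen_iInter_of_finite fun i => ?_
  rw [← isClosed_compl_iff]
  exact isClosed_iff_exists_forall_eval_eq_zero.2 ⟨{X i}, by ext; simp⟩

theorem closure_eq_zeroLocus_vanishingIdeal (S : Set (Sym2 G → F)) :
    closure S = zeroLocus F (vanishingIdeal F S) := by
  apply (closure_minimal (zeroLocus_vanishingIdeal_le S) (isClosed_zeroLocus _)).antisymm
  intro x hx
  obtain ⟨P, hP⟩ := isClosed_iff_exists_forall_eval_eq_zero.1 (isClosed_closure (s := S))
  rw [hP]
  intro p hp
  have : p ∈ vanishingIdeal F S := fun y hy => by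
    have := subset_closure hy
    rw [hP] at this
    simpa using this p hp
  simpa using hx p this

theorem zeroLocus_vanishingIdeal_of_isClosed {S : Set (Sym2 G → F)} (hS : IsClosed S) :
    zeroLocus F (vanishingIdeal F S) = S := by
  rw [← closure_eq_zeroLocus_vanishingIdeal, hS.closure_eq]

theorem vanishingIdeal_closure (S : Set (Sym2 G → F)) :
    vanishingIdeal F (closure S) = vanishingIdeal F S := by
  apply (vanishingIdeal_anti_mono subset_closure).antisymm
  rw [closure_eq_zeroLocus_vanishingIdeal]
  exact le_vanishingIdeal_zeroLocus _

theorem isIrreducible_iff_isPrime_vanishingIdeal {S : Set (Sym2 G → F)} :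
    IsIrreducible S ↔ (vanishingIdeal F S).IsPrime := by
  constructor
  · rintro ⟨⟨x, hx⟩, hS⟩
    rw [isPreirreducible_iff_isClosed_union_isClosed] at hS
    refine ⟨(Ideal.ne_top_iff_one _).2 fun h => by simpa using h x hx, fun {f g} hfg => ?_⟩
    have closed (p : MvPolynomial (Sym2 G) F) : IsClosed {x : Sym2 G → F | eval x p = 0} :=
      isClosed_iff_exists_forall_eval_eq_zero.2 ⟨{p}, by simp⟩
    refine (hS _ _ (closed f) (closed g) fun y hy => ?_).imp
      (fun h y hy => by simpa using h hy) (fun h y hy => by simpa using h hy)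
    simpa using hfg y hy
  · intro hS
    refine ⟨Set.nonempty_iff_ne_empty.2 fun h => hS.ne_top (h ▸ vanishingIdeal_empty), ?_⟩
    rw [isPreirreducible_iff_isClosed_union_isClosed]
    intro A B hA hB hAB
    rw [← zeroLocus_vanishingIdeal_of_isClosed hA, ← zeroLocus_vanishingIdeal_of_isClosed hB]
    rw [le_zeroLocus_iff_le_vanishingIdeal, le_zeroLocus_iff_le_vanishingIdeal]
    refine hS.mul_le.1 (Ideal.mul_le.2 fun f hf g hg y hy => ?_)
    rw [map_mul]
    rcases hAB hy with h | h
    · rw [hf y h, zero_mul]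
    · rw [hg y h, mul_zero]

theorem isIrreducible_coe_image {Z : Set (Sym2 G → F)} (C : IrreducibleCloseds Z) :
    IsIrreducible ((↑) '' (C : Set Z) : Set (Sym2 G → F)) :=
  C.isIrreducible.image _ continuous_subtype_val.continuousOn

theorem isIrreducible_of_isIrreducible_coe_image {α : Type*} [TopologicalSpace α] {Z : Set α}
    {S : Set Z} (hS : IsIrreducible ((↑) '' S : Set α)) : IsIrreducible S := by
  refine ⟨hS.nonempty.of_image, fun u v hu hv => ?_⟩
  obtain ⟨u, hu', rfl⟩ := isOpen_induced_iff.1 hu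
  obtain ⟨v, hv', rfl⟩ := isOpen_induced_iff.1 hv
  rintro ⟨x, hxS, hxu⟩ ⟨y, hyS, hyv⟩
  obtain ⟨_, ⟨z, hz, rfl⟩, hzuv⟩ :=
    hS.isPreirreducible u v hu' hv' ⟨x, ⟨x, hxS, rfl⟩, hxu⟩ ⟨y, ⟨y, hyS, rfl⟩, hyv⟩
  exact ⟨z, hz, hzuv⟩

/-- Irreducible closed subsets of a Zariski closed set `Z` correspond to primes containing the
vanishing ideal of `Z`. -/
noncomputable def irreducibleClosedsOrderIso [Finite G] [IsAlgClosed F] {Z : Set (Sym2 G → F)}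
    (hZ : IsClosed Z) :
    IrreducibleCloseds Z ≃o
      (PrimeSpectrum.zeroLocus (vanishingIdeal F Z : Set (MvPolynomial (Sym2 G) F)))ᵒᵈ :=
  have image_preimage (p : Ideal (MvPolynomial (Sym2 G) F)) (hp : vanishingIdeal F Z ≤ p) :
      (Subtype.val '' (Subtype.val ⁻¹' zeroLocus F p : Set Z) : Set (Sym2 G → F)) =
        zeroLocus F p := by
    rw [Subtype.image_preimage_coe, Set.inter_eq_right]
    exact (zeroLocus_anti_mono hp).trans (zeroLocus_vanishingIdeal_of_isClosed hZ).le
  have zeroLocus_image (C : IrreducibleCloseds Z) :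
      zeroLocus F (vanishingIdeal F (Subtype.val '' (C : Set Z) : Set (Sym2 G → F))) =
        Subtype.val '' (C : Set Z) :=
    zeroLocus_vanishingIdeal_of_isClosed (hZ.isClosedEmbedding_subtypeVal.isClosedMap _ C.isClosed)
  { toFun C := OrderDual.toDual
      ⟨⟨vanishingIdeal F (Subtype.val '' (C : Set Z)),
        isIrreducible_iff_isPrime_vanishingIdeal.1 (isIrreducible_coe_image C)⟩,
        vanishingIdeal_anti_mono (by simp)⟩
    invFun p :=
      { carrier := Subtype.val ⁻¹' zeroLocus F (OrderDual.ofDual p).1.asIdeal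
        isIrreducible' := by
          have hp : (OrderDual.ofDual p).1.asIdeal.IsPrime := inferInstance
          apply isIrreducible_of_isIrreducible_coe_image
          rw [image_preimage _ (OrderDual.ofDual p).2, isIrreducible_iff_isPrime_vanishingIdeal,
            IsPrime.vanishingIdeal_zeroLocus]
          exact hp
        isClosed' := (isClosed_zeroLocus _).preimage continuous_subtype_val }
    left_inv C := by
      ext x
      change x.1 ∈ zeroLocus F (vanishingIdeal F (Subtype.val '' (C : Set Z))) ↔ x ∈ C
      rw [zeroLocus_image C]
      simp
    right_inv p := by
      apply OrderDual.ofDual.injective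
      apply Subtype.ext
      apply PrimeSpectrum.ext
      change vanishingIdeal F
        (Subtype.val '' (Subtype.val ⁻¹' zeroLocus F (OrderDual.ofDual p).1.asIdeal)) = _
      rw [image_preimage _ (OrderDual.ofDual p).2, IsPrime.vanishingIdeal_zeroLocus]
    map_rel_iff' {C D} := by
      change vanishingIdeal F (Subtype.val '' (D : Set Z)) ≤
        vanishingIdeal F (Subtype.val '' (C : Set Z)) ↔ C ≤ D
      constructor
      · intro h
        rw [← le_zeroLocus_iff_le_vanishingIdeal, zeroLocus_image D] at h
        exact (Set.image_subset_image_iff Subtype.val_injective).1 h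
      · exact fun h => vanishingIdeal_anti_mono (Set.image_mono h) }

theorem topologicalKrullDim_eq_ringKrullDim [Finite G] [IsAlgClosed F] {Z : Set (Sym2 G → F)}
    (hZ : IsClosed Z) :
    topologicalKrullDim Z = ringKrullDim (MvPolynomial (Sym2 G) F ⧸ vanishingIdeal F Z) := by
  rw [ringKrullDim_quotient, ← Order.krullDim_orderDual]
  exact Order.krullDim_eq_of_orderIso (irreducibleClosedsOrderIso hZ)

end ZariskiTopology

section KrullDimension

theorem ringKrullDim_eq_of_isIntegral_of_injective {R S : Type*} [CommRing R] [CommRing S]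
    [Algebra R S] [Algebra.IsIntegral R S] (h : Function.Injective (algebraMap R S)) :
    ringKrullDim S = ringKrullDim R := by
  apply le_antisymm
  · exact Order.krullDim_le_of_strictMono (PrimeSpectrum.comap (algebraMap R S))
      fun p q hpq => Ideal.IsIntegral.comap_lt_comap hpq
  · refine iSup_le fun l => ?_
    obtain ⟨P, hP, hPl⟩ := Ideal.exists_ideal_over_prime_of_isIntegral
      (S := S) l.head.asIdeal ⊥ (by
        rw [← RingHom.ker_eq_comap_bot, (RingHom.injective_iff_ker_eq_bot _).1 h]
        exact bot_le)
    have : P.LiesOver l.head.asIdeal := ⟨hPl.2.symm⟩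
    have : P.IsPrime := hPl.1
    obtain ⟨L, hL, -⟩ := Ideal.exists_ltSeries_of_hasGoingUp l P
    rw [← hL]
    exact le_iSup (fun L : LTSeries (PrimeSpectrum S) => (L.length : WithBot ℕ∞)) L

theorem ringKrullDim_eq_of_trdeg_eq (k A : Type*) [Field k] [CommRing A] [IsDomain A]
    [Algebra k A] [Algebra.FiniteType k A] {n : ℕ} (h : Algebra.trdeg k A = n) :
    ringKrullDim A = n := by
  obtain ⟨s, g, hg, hint⟩ := exists_integral_inj_algHom_of_fg k A
  algebraize [g.toRingHom]
  have : IsScalarTower k (MvPolynomial (Fin s) k) A := .of_algebraMap_eq' g.comp_algebraMap.symm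
  have hinj : Function.Injective (algebraMap (MvPolynomial (Fin s) k) A) := hg
  have := (faithfulSMul_iff_algebraMap_injective _ _).2 hinj
  have : Algebra.IsIntegral (MvPolynomial (Fin s) k) A := ⟨hint⟩
  have := lift_trdeg_add_eq k (MvPolynomial (Fin s) k) A
  rw [trdeg_eq_zero (R := MvPolynomial (Fin s) k), h] at this
  simp at this
  rw [ringKrullDim_eq_of_isIntegral_of_injective hinj,
    MvPolynomial.ringKrullDim_of_isNoetherianRing]
  simp [ringKrullDim_eq_zero_of_field, this]

end KrullDimension

section Cocycle

theorem exists_retraction_of_surjective_pow {A E : Type*} [CommGroup A] [CommGroup E]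
    (hA : ∀ n : ℕ, n ≠ 0 → Function.Surjective fun a : A => a ^ n) (i : A →* E)
    (hi : Function.Injective i) : ∃ r : E →* A, ∀ a, r (i a) = a := by
  let : DivisibleBy (Additive A) ℕ := divisibleByOfSMulRightSurj _ _ fun hn => hA _ hn
  let : DivisibleBy (Additive A) ℤ := AddGroup.divisibleByIntOfDivisibleByNat _
  obtain ⟨r, hr⟩ := (Module.Baer.of_divisible (Additive A)).extension_property_addMonoidHom
    (MonoidHom.toAdditive i) hi (AddMonoidHom.id _)
  exact ⟨MonoidHom.toAdditive.symm r, fun a => DFunLike.congr_fun hr (Additive.ofMul a)⟩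

/-- The underlying set of the extension of `G` by `A` defined by a `2`-cocycle `c`. -/
@[ext]
structure CocycleExtension {A G : Type*} (c : G → G → A) where
  /-- The component in `A`. -/
  fst : A
  /-- The component in `G`. -/
  snd : G

/-- The abelian extension of `G` by `A` defined by a symmetric `2`-cocycle `c`: the product of
`(a, g)` and `(b, h)` is `(a * b * c g h, g * h)`. -/
@[reducible]
def CocycleExtension.commGroup {A G : Type*} [CommGroup A] [CommGroup G] (c : G → G → A)
    (hsymm : ∀ g h, c g h = c h g) (hc : ∀ g h k, c g h * c (g * h) k = c h k * c g (h * k)) :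
    CommGroup (CocycleExtension c) where
  mul p q := ⟨p.1 * q.1 * c p.2 q.2, p.2 * q.2⟩
  one := ⟨(c 1 1)⁻¹, 1⟩
  inv p := ⟨(p.1 * c p.2⁻¹ p.2 * c 1 1)⁻¹, p.2⁻¹⟩
  mul_assoc p q r := by
    refine CocycleExtension.ext ?_ (mul_assoc _ _ _)
    change p.1 * q.1 * c p.2 q.2 * r.1 * c (p.2 * q.2) r.2 =
      p.1 * (q.1 * r.1 * c q.2 r.2) * c p.2 (q.2 * r.2)
    calc _ = p.1 * q.1 * r.1 * (c p.2 q.2 * c (p.2 * q.2) r.2) := by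
          simp only [mul_assoc, mul_left_comm, mul_comm]
      _ = _ := by rw [hc]; simp only [mul_assoc]
  one_mul p := by
    refine CocycleExtension.ext ?_ (one_mul _)
    change (c 1 1)⁻¹ * p.1 * c 1 p.2 = p.1
    have c_one : c 1 p.2 = c 1 1 := by simpa [mul_comm] using (hc 1 1 p.2).symm
    rw [c_one, mul_comm _ p.1, inv_mul_cancel_right]
  mul_one p := by
    refine CocycleExtension.ext ?_ (mul_one _)
    change p.1 * (c 1 1)⁻¹ * c p.2 1 = p.1
    have c_one : c 1 p.2 = c 1 1 := by simpa [mul_comm] using (hc 1 1 p.2).symm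
    rw [hsymm p.2 1, c_one, inv_mul_cancel_right]
  inv_mul_cancel p := by
    refine CocycleExtension.ext ?_ (inv_mul_cancel _)
    change (p.1 * c p.2⁻¹ p.2 * c 1 1)⁻¹ * p.1 * c p.2⁻¹ p.2 = (c 1 1)⁻¹
    rw [mul_assoc, mul_inv, mul_right_comm, inv_mul_cancel, one_mul]
  mul_comm p q := by
    refine CocycleExtension.ext ?_ (mul_comm _ _)
    change p.1 * q.1 * c p.2 q.2 = q.1 * p.1 * c q.2 p.2
    rw [mul_comm p.1, hsymm]

theorem exists_coboundary_of_symmetric_cocycle {A G : Type*} [CommGroup A] [CommGroup G]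
    (hA : ∀ n : ℕ, n ≠ 0 → Function.Surjective fun a : A => a ^ n) (c : G → G → A)
    (hsymm : ∀ g h, c g h = c h g) (hc : ∀ g h k, c g h * c (g * h) k = c h k * c g (h * k)) :
    ∃ α : G → A, ∀ g h, c g h = α g * α h * (α (g * h))⁻¹ := by
  let := CocycleExtension.commGroup c hsymm hc
  have mul_def (p q : CocycleExtension c) : p * q = ⟨p.1 * q.1 * c p.2 q.2, p.2 * q.2⟩ := rfl
  have c_one (g : G) : c 1 g = c 1 1 := by simpa [mul_comm] using (hc 1 1 g).symm
  let i : A →* CocycleExtension c :=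
    { toFun a := ⟨a * (c 1 1)⁻¹, 1⟩
      map_one' := by rw [one_mul]; rfl
      map_mul' a b := by
        rw [mul_def]
        refine CocycleExtension.ext ?_ (mul_one _).symm
        change a * b * (c 1 1)⁻¹ = a * (c 1 1)⁻¹ * (b * (c 1 1)⁻¹) * c 1 1
        rw [mul_assoc (a * (c 1 1)⁻¹), inv_mul_cancel_right, mul_right_comm] }
  obtain ⟨r, hr⟩ := exists_retraction_of_surjective_pow hA i fun a b h =>
    mul_right_cancel (congrArg CocycleExtension.fst h : a * (c 1 1)⁻¹ = b * (c 1 1)⁻¹)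
  refine ⟨fun g => r ⟨1, g⟩, fun g h => ?_⟩
  rw [eq_mul_inv_iff_mul_eq, ← map_mul, ← hr (c g h), ← map_mul, mul_def, mul_def]
  congr 1
  refine CocycleExtension.ext ?_ (one_mul _)
  change c g h * (c 1 1)⁻¹ * 1 * c 1 (g * h) = 1 * 1 * c g h
  rw [c_one (g * h)]
  group

end Cocycle

section OnesOrbit

open MvPolynomial

variable {G F}

theorem onesOrbit_eq_setOf_ne_zero [IsAlgClosed F] :
    onesOrbit G F = contractionVariety G F ∩ {x | ∀ i, x i ≠ 0} := by
  ext x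
  constructor
  · rintro ⟨α, rfl⟩
    refine ⟨fun g h k => ?_, fun i => ?_⟩
    · simp only [dal, Sym2.lift_mk]
      rw [← Units.val_mul, ← Units.val_mul, mul_assoc g h k]
      congr 1
      generalize α (g * h) = a
      generalize α (h * k) = b
      generalize α (g * (h * k)) = c
      calc α g * α h * a⁻¹ * (a * α k * c⁻¹) = α g * (α h * α k) * c⁻¹ := by group
        _ = α h * α k * α g * c⁻¹ := by rw [mul_comm (α g)]
        _ = α h * α k * b⁻¹ * (b * α g * c⁻¹) := by group
        _ = α h * α k * b⁻¹ * (α g * b * c⁻¹) := by rw [mul_comm b]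
    · induction i with
      | _ g h => exact Units.ne_zero (α g * α h * (α (g * h))⁻¹)
  · rintro ⟨hx, hne⟩
    obtain ⟨α, hα⟩ := exists_coboundary_of_symmetric_cocycle (A := Fˣ) (G := G)
      (fun n hn a => by
        obtain ⟨z, hz⟩ := IsAlgClosed.exists_pow_nat_eq (a : F) (Nat.pos_of_ne_zero hn)
        have hz0 : z ≠ 0 := by
          rintro rfl
          exact a.ne_zero (by rw [← hz, zero_pow hn])
        exact ⟨Units.mk0 z hz0, Units.ext (by simpa using hz)⟩)
      (fun g h => Units.mk0 (x s(g, h)) (hne _))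
      (fun g h => by simp only [Sym2.eq_swap])
      (fun g h k => Units.ext (by simpa using hx g h k))
    refine ⟨α, funext fun i => ?_⟩
    induction i with
    | _ g h => simpa [dal] using congrArg Units.val (hα g h)

theorem isClosed_contractionVariety : IsClosed (contractionVariety G F) := by
  refine isClosed_iff_exists_forall_eval_eq_zero.2
    ⟨{p | ∃ g h k, p = X s(g, h) * X s(g * h, k) - X s(h, k) * X s(g, h * k)}, ?_⟩
  ext x
  constructor
  · rintro hx p ⟨g, h, k, rfl⟩
    simpa [sub_eq_zero] using hx g h k
  · intro hx g h k
    simpa [sub_eq_zero] using hx _ ⟨g, h, k, rfl⟩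

theorem one_mem_onesOrbit : (fun _ => (1 : F)) ∈ onesOrbit G F :=
  ⟨1, funext fun i => by induction i with | _ g h => simp [dal]⟩

theorem subset_closure_onesOrbit [Finite G] [IsAlgClosed F] {C : Set (Sym2 G → F)}
    (hCX : C ⊆ contractionVariety G F) (hC : IsIrreducible C) (h : (fun _ => (1 : F)) ∈ C) :
    C ⊆ closure (onesOrbit G F) := by
  refine (subset_closure_inter_of_isPreirreducible_of_isOpen hC.isPreirreducible
    isOpen_setOf_forall_ne_zero ⟨_, h, fun _ => one_ne_zero⟩).trans (closure_mono ?_)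
  rw [onesOrbit_eq_setOf_ne_zero]
  exact Set.inter_subset_inter_left _ hCX

end OnesOrbit

section CoordinateRing

open MvPolynomial

/-- The polynomials in the variables `t_g`, `g ∈ G`, without zeros on the torus `(F^×)^G`. -/
def torusSubmonoid (G : Type u) (F : Type v) [Field F] : Submonoid (MvPolynomial G F) where
  carrier := {p | ∀ α : G → Fˣ, aeval (fun g => (α g : F)) p ≠ 0}
  one_mem' α := by rw [map_one]; exact one_ne_zero
  mul_mem' hp hq α := by rw [map_mul]; exact mul_ne_zero (hp α) (hq α)

theorem torusSubmonoid_le_nonZeroDivisors (G : Type u) (F : Type v) [Field F] :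
    torusSubmonoid G F ≤ nonZeroDivisors (MvPolynomial G F) :=
  le_nonZeroDivisors_of_noZeroDivisors fun h => h 1 (map_zero _)

/-- The ring of regular functions on the torus `(F^×)^G`. -/
abbrev TorusRing (G : Type u) (F : Type v) [Field F] : Type max u v :=
  Localization (torusSubmonoid G F)

instance (G : Type u) (F : Type v) [Field F] : IsDomain (TorusRing G F) :=
  IsLocalization.isDomain_localization (torusSubmonoid_le_nonZeroDivisors G F)

/-- Evaluation of a regular function at a point of the torus. -/
noncomputable def evalTorus {G : Type u} {F : Type v} [Field F] (α : G → Fˣ) :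
    TorusRing G F →ₐ[F] F :=
  IsLocalization.liftAlgHom (M := torusSubmonoid G F) (f := aeval fun g => (α g : F))
    fun p => (p.2 α).isUnit

theorem evalTorus_algebraMap {G : Type u} {F : Type v} [Field F] (α : G → Fˣ)
    (p : MvPolynomial G F) : evalTorus α (algebraMap _ _ p) = eval (fun g => (α g : F)) p := by
  rw [← aeval_eq_eval]
  exact IsLocalization.lift_eq _ p

theorem eq_zero_of_forall_evalTorus {G : Type u} {F : Type v} [Field F] [Infinite F]
    {r : TorusRing G F} (h : ∀ α, evalTorus α r = 0) : r = 0 := by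
  obtain ⟨p, s, rfl⟩ := IsLocalization.exists_mk'_eq (torusSubmonoid G F) r
  suffices p = 0 by rw [this, IsLocalization.mk'_zero]
  refine funext_set (fun _ => {0}ᶜ) (fun _ => (Set.finite_singleton 0).infinite_compl)
    fun x hx => ?_
  have := congrArg (evalTorus fun g => Units.mk0 (x g) (hx g trivial))
    (IsLocalization.mk'_spec (TorusRing G F) p s)
  rw [map_mul, h, zero_mul, evalTorus_algebraMap] at this
  rw [map_zero]
  exact this.symm

/-- The coordinate functions on the torus. -/
noncomputable def torusCoordinate (F : Type v) [Field F] {G : Type u} (g : G) :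
    (TorusRing G F)ˣ :=
  (IsLocalization.map_units (M := torusSubmonoid G F) (TorusRing G F)
    ⟨X g, fun α => by simp⟩).unit

theorem map_evalTorus_torusCoordinate {G : Type u} {F : Type v} [Field F] (α : G → Fˣ) (g : G) :
    Units.map (evalTorus α : TorusRing G F →* F) (torusCoordinate F g) = α g :=
  Units.ext ((evalTorus_algebraMap α (X g)).trans (eval_X _))

/-- The comorphism of the parametrization `α ↦ dα` of the orbit of the all-ones tuple. -/
noncomputable def coboundaryHom : MvPolynomial (Sym2 G) F →ₐ[F] TorusRing G F :=
  aeval (Sym2.lift ⟨fun g h => ((torusCoordinate F g * torusCoordinate F h *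
    (torusCoordinate F (g * h))⁻¹ : (TorusRing G F)ˣ) : TorusRing G F),
    fun g h => by dsimp only; rw [mul_comm h g, mul_comm (torusCoordinate F h)]⟩)

variable {G F}

theorem coboundaryHom_X (g h : G) : coboundaryHom G F (X s(g, h)) =
    ((torusCoordinate F g * torusCoordinate F h * (torusCoordinate F (g * h))⁻¹ :
      (TorusRing G F)ˣ) : TorusRing G F) := by
  simp [coboundaryHom]

theorem evalTorus_coboundaryHom (α : G → Fˣ) (p : MvPolynomial (Sym2 G) F) :
    evalTorus α (coboundaryHom G F p) = aeval (dal G F α) p := by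
  suffices (evalTorus α).comp (coboundaryHom G F) = aeval (dal G F α) from
    DFunLike.congr_fun this p
  refine algHom_ext fun i => ?_
  induction i with
  | _ g h =>
    rw [AlgHom.comp_apply, coboundaryHom_X, aeval_X]
    change ((Units.map (evalTorus α : TorusRing G F →* F) _ : Fˣ) : F) = _
    simp only [map_mul, map_inv, map_evalTorus_torusCoordinate]
    rfl

theorem vanishingIdeal_onesOrbit [Infinite F] :
    vanishingIdeal F (onesOrbit G F) = RingHom.ker (coboundaryHom G F) := by
  ext p
  rw [RingHom.mem_ker]
  constructor
  · intro hp
    exact eq_zero_of_forall_evalTorus fun α => by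
      rw [evalTorus_coboundaryHom]
      exact hp _ ⟨α, rfl⟩
  · rintro hp _ ⟨α, rfl⟩
    rw [← evalTorus_coboundaryHom, hp, map_zero]

theorem coboundaryHom_prod_X [Fintype G] (g : G) :
    coboundaryHom G F (∏ h, X s(g, h)) =
      algebraMap (MvPolynomial G F) (TorusRing G F) (X g ^ Fintype.card G) := by
  simp only [map_prod, coboundaryHom_X]
  rw [← Units.coe_prod, Finset.prod_mul_distrib, Finset.prod_mul_distrib,
    Finset.prod_inv_distrib, Fintype.prod_equiv (Equiv.mulLeft g)
      (fun h => torusCoordinate F (g * h)) (fun h => torusCoordinate F h) fun _ => rfl,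
    mul_inv_cancel_right]
  simp [torusCoordinate]

theorem trdeg_torusRing (G : Type u) (F : Type v) [Field F] [Finite G] :
    Algebra.trdeg F (TorusRing G F) = Nat.card G := by
  have : FaithfulSMul (MvPolynomial G F) (TorusRing G F) :=
    (faithfulSMul_iff_algebraMap_injective _ _).2
      (IsLocalization.injective _ (torusSubmonoid_le_nonZeroDivisors G F))
  have := IsLocalization.isAlgebraic (S := TorusRing G F) (torusSubmonoid G F)
  rw [← trdeg_add_eq F (MvPolynomial G F), trdeg_eq_zero (R := MvPolynomial G F), add_zero,
    trdeg_of_isDomain]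
  simp [Nat.cast_card]

theorem algebraicIndependent_prod_X [Fintype G] :
    AlgebraicIndependent F fun g : G =>
      Ideal.Quotient.mkₐ F (RingHom.ker (coboundaryHom G F)) (∏ h, X s(g, h)) := by
  refine AlgebraicIndependent.of_comp (Ideal.kerLiftAlg (coboundaryHom G F)) ?_
  rw [algebraicIndependent_iff_injective_aeval]
  have : aeval (Ideal.kerLiftAlg (coboundaryHom G F) ∘ fun g : G =>
      Ideal.Quotient.mkₐ F (RingHom.ker (coboundaryHom G F)) (∏ h, X s(g, h))) =
      (IsScalarTower.toAlgHom F (MvPolynomial G F) (TorusRing G F)).comp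
        (expand (Fintype.card G)) :=
    algHom_ext fun g => by
      rw [aeval_X, AlgHom.comp_apply, expand_X]
      exact coboundaryHom_prod_X g
  rw [this]
  exact (IsLocalization.injective (TorusRing G F) (torusSubmonoid_le_nonZeroDivisors G F)).comp
    (expand_injective Fintype.card_pos)

theorem trdeg_quotient_ker_coboundaryHom [Finite G] :
    Algebra.trdeg F (MvPolynomial (Sym2 G) F ⧸ RingHom.ker (coboundaryHom G F)) = Nat.card G := by
  have := Fintype.ofFinite G
  apply le_antisymm
  · rw [← trdeg_torusRing G F]
    exact trdeg_le_of_injective (Ideal.kerLiftAlg (coboundaryHom G F))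
      (Ideal.kerLiftAlg_injective _)
  · have := (algebraicIndependent_prod_X (G := G) (F := F)).lift_cardinalMk_le_trdeg
    simpa using this

end CoordinateRing

/-- `X(1̄)` is the (Zariski) closure of the orbit of `1̄`; being an
irreducible component of `X` means being a maximal irreducible subset of `X`; the
dimension is the topological Krull dimension (the supremum of lengths of chains of
irreducible closed subsets). -/
theorem closure_onesOrbit_unique_irreducible_component [Finite G] [IsAlgClosed F] :
    (closure (onesOrbit G F) ⊆ contractionVariety G F ∧
      (fun _ => (1 : F)) ∈ closure (onesOrbit G F) ∧
      IsIrreducible (closure (onesOrbit G F)) ∧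
      (∀ C : Set (Sym2 G → F), C ⊆ contractionVariety G F → IsIrreducible C →
        closure (onesOrbit G F) ⊆ C → C = closure (onesOrbit G F)) ∧
      (∀ C : Set (Sym2 G → F), C ⊆ contractionVariety G F → IsIrreducible C →
        (fun _ => (1 : F)) ∈ C →
        (∀ C' : Set (Sym2 G → F), C' ⊆ contractionVariety G F → IsIrreducible C' →
          C ⊆ C' → C = C') →
        C = closure (onesOrbit G F))) ∧
    topologicalKrullDim ↥(closure (onesOrbit G F)) = (Nat.card G : WithBot ℕ∞) := by
  have hX : closure (onesOrbit G F) ⊆ contractionVariety G F :=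
    closure_minimal (onesOrbit_eq_setOf_ne_zero.trans_subset Set.inter_subset_left)
      isClosed_contractionVariety
  have hone : (fun _ => (1 : F)) ∈ closure (onesOrbit G F) := subset_closure one_mem_onesOrbit
  have hI := (vanishingIdeal_closure (onesOrbit G F)).trans vanishingIdeal_onesOrbit
  have hirr : IsIrreducible (closure (onesOrbit G F)) := by
    rw [isIrreducible_iff_isPrime_vanishingIdeal, hI]
    exact RingHom.ker_isPrime _
  refine ⟨⟨hX, hone, hirr, fun C hCX hC h => (subset_closure_onesOrbit hCX hC (h hone)).antisymm h,
    fun C hCX hC h hmax => hmax _ hX hirr (subset_closure_onesOrbit hCX hC h)⟩, ?_⟩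
  rw [topologicalKrullDim_eq_ringKrullDim isClosed_closure, hI]
  have : (RingHom.ker (coboundaryHom G F)).IsPrime := RingHom.ker_isPrime _
  exact ringKrullDim_eq_of_trdeg_eq F _ trdeg_quotient_ker_coboundaryHom
end

section
/- Let G be an abelian group, S a finite subset of P_G, and F an algebraically closed field. For an element r ∈ F_S, the following are equivalent: (1) χ(r) = 1 for every homomorphism χ: F_S → F^× of the form χ = (dα)|_{F_S} for some map α: G → F^× (where dα denotes the homomorphism F_G → F^× sending {g,h} to α(g)α(h)α(gh)^{-1}); (2) r ∈ ⟨R_G⟩ ∩ F_S. -/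
/-!
STATEMENT 13: For a finite subset `S ⊆ P_G` and an algebraically closed field `F`, an
element `r ∈ F_S` satisfies `χ(r) = 1` for every character `χ : F_S → F^×` of the form
`(dα)|_{F_S}` (α : G → F^× arbitrary) if and only if `r ∈ ⟨R_G⟩ ∩ F_S`.
(`F_G`, `F_S` and `F^×` are written additively: `F^×` is `Additive Fˣ`, the coboundary
`dα : F_G → Additive Fˣ` sends `{g,h}` to `α(g)·α(h)·α(gh)⁻¹`, and `χ(r) = 1` reads
`dα(r) = 0`.)
-/

universe u v

open FreeAbelianGroup

variable (G : Type u) [CommGroup G]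

variable {G}

/-- The subgroup `F_S` of `F_G` generated by `S ⊆ P_G`. -/
def FS (S : Set (Sym2 G)) : AddSubgroup (FreeAbelianGroup (Sym2 G)) :=
  AddSubgroup.closure (of '' S)

variable (F : Type v) [Field F]

/-- The coboundary `dα : F_G → F^×` of a map `α : G → F^×`,
`{g,h} ↦ α(g)·α(h)·α(gh)⁻¹` (with `F^×` written additively). -/
noncomputable def cobU (α : G → Fˣ) : FreeAbelianGroup (Sym2 G) →+ Additive Fˣ :=
  FreeAbelianGroup.lift (Sym2.lift
    ⟨fun g h => Additive.ofMul (α g * α h * (α (g * h))⁻¹),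
      fun g h => by dsimp only; rw [mul_comm h g, mul_comm (α h) (α g)]⟩)

/-- The universal coboundary `F_G → ℤ[G]`, `{g,h} ↦ g + h - gh`. -/
noncomputable def cobFree : FreeAbelianGroup (Sym2 G) →+ FreeAbelianGroup G :=
  FreeAbelianGroup.lift (Sym2.lift
    ⟨fun g h => of g + of h - of (g * h),
      fun g h => by dsimp only; rw [mul_comm h g, add_comm (of h) (of g)]⟩)

theorem cobFree_of (g h : G) : cobFree (of s(g, h)) = of g + of h - of (g * h) := by
  simp [cobFree]

theorem cobU_eq_lift_cobFree (α : G → Fˣ) (x : FreeAbelianGroup (Sym2 G)) :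
    cobU F α x = FreeAbelianGroup.lift (fun g => Additive.ofMul (α g)) (cobFree x) := by
  suffices h : cobU F α =
      (FreeAbelianGroup.lift (fun g => Additive.ofMul (α g))).comp cobFree from
    DFunLike.congr_fun h x
  ext p
  induction p using Sym2.ind with
  | _ g h =>
    simp [cobU, cobFree_of, div_eq_mul_inv]

theorem cobFree_eq_zero_of_mem_RG {x : FreeAbelianGroup (Sym2 G)} (hx : x ∈ RG G) :
    cobFree x = 0 := by
  suffices h : RG G ≤ (cobFree (G := G)).ker from h hx
  refine (AddSubgroup.closure_le _).2 ?_
  rintro _ ⟨g, h, k, rfl⟩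
  simp only [SetLike.mem_coe, AddMonoidHom.mem_ker, map_add, map_sub, cobFree_of, mul_assoc]
  abel

/-- A symmetric 2-cocycle on `G` with values in an additive group `A`. -/
structure SymmCocycle_s13 (G : Type*) [CommGroup G] (A : Type*) [AddCommGroup A] where
  /-- The underlying function of two variables. -/
  toFun : G → G → A
  symm : ∀ g h, toFun g h = toFun h g
  cocycle : ∀ g h k, toFun g h + toFun (g * h) k = toFun h k + toFun g (h * k)

namespace SymmCocycle_s13

variable {G : Type*} [CommGroup G] {A : Type*} [AddCommGroup A]

theorem one_left_s13 (f : SymmCocycle_s13 G A) (g : G) : f.toFun 1 g = f.toFun 1 1 := by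
  have := f.cocycle 1 1 g
  simp only [one_mul] at this
  exact (add_right_cancel this).symm

/-- The underlying set of the abelian extension of `G` by `A` defined by a symmetric cocycle. -/
@[ext]
structure Extension_s13 (f : SymmCocycle_s13 G A) where
  /-- The component in the kernel. -/
  fst : A
  /-- The image in the quotient. -/
  snd : G

variable (f : SymmCocycle_s13 G A)

instance : Add f.Extension_s13 :=
  ⟨fun x y => ⟨x.fst + y.fst + f.toFun x.snd y.snd, x.snd * y.snd⟩⟩

instance : Zero f.Extension_s13 := ⟨⟨-f.toFun 1 1, 1⟩⟩

instance : Neg f.Extension_s13 :=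
  ⟨fun x => ⟨-x.fst - f.toFun 1 1 - f.toFun x.snd⁻¹ x.snd, x.snd⁻¹⟩⟩

theorem Extension_s13.add_def (x y : f.Extension_s13) :
    x + y = ⟨x.fst + y.fst + f.toFun x.snd y.snd, x.snd * y.snd⟩ := rfl

theorem Extension_s13.zero_def : (0 : f.Extension_s13) = ⟨-f.toFun 1 1, 1⟩ := rfl

theorem Extension_s13.neg_def (x : f.Extension_s13) :
    -x = ⟨-x.fst - f.toFun 1 1 - f.toFun x.snd⁻¹ x.snd, x.snd⁻¹⟩ := rfl

theorem Extension_s13.add_comm' (x y : f.Extension_s13) : x + y = y + x := by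
  simp only [Extension_s13.add_def, f.symm x.snd y.snd, mul_comm x.snd y.snd, add_comm x.fst y.fst]

theorem Extension_s13.zero_add' (x : f.Extension_s13) : 0 + x = x := by
  ext <;> simp [Extension_s13.add_def, Extension_s13.zero_def, f.one_left_s13]

instance : AddCommGroup f.Extension_s13 where
  add_assoc x y z := by
    ext
    · have := f.cocycle x.snd y.snd z.snd
      simp only [Extension_s13.add_def]
      rw [show ∀ a b c p q : A, a + b + p + c + q = a + b + c + (p + q) by intros; abel, this]
      abel
    · simp [Extension_s13.add_def, mul_assoc]
  zero_add := Extension_s13.zero_add' f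
  add_zero x := by rw [Extension_s13.add_comm', Extension_s13.zero_add']
  nsmul := nsmulRec
  zsmul := zsmulRec
  neg_add_cancel x := by
    ext
    · simp only [Extension_s13.add_def, Extension_s13.neg_def, Extension_s13.zero_def]
      abel
    · simp [Extension_s13.add_def, Extension_s13.neg_def, Extension_s13.zero_def]
  add_comm := Extension_s13.add_comm' f

/-- The inclusion of the kernel into the extension. -/
def Extension_s13.inl : A →+ f.Extension_s13 :=
  AddMonoidHom.mk' (fun a => ⟨a - f.toFun 1 1, 1⟩) fun a b => by
    ext
    · simp only [Extension_s13.add_def]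
      abel
    · simp [Extension_s13.add_def]

theorem Extension_s13.inl_injective : Function.Injective (Extension_s13.inl f) := fun a b h => by
  simpa [Extension_s13.inl] using congrArg Extension_s13.fst h

/-- Symmetric cocycles with values in an injective group are coboundaries. -/
theorem exists_eq_coboundary (hA : Module.Baer ℤ A) :
    ∃ β : G → A, ∀ g h, f.toFun g h = β g + β h - β (g * h) := by
  obtain ⟨ρ, hρ⟩ := hA.extension_property_addMonoidHom (Extension_s13.inl f)
    (Extension_s13.inl_injective f) (AddMonoidHom.id A)
  refine ⟨fun g => ρ ⟨0, g⟩, fun g h => ?_⟩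
  have key : (⟨0, g⟩ + ⟨0, h⟩ : f.Extension_s13) =
      Extension_s13.inl f (f.toFun g h) + ⟨0, g * h⟩ := by
    ext <;> simp [Extension_s13.add_def, Extension_s13.inl, f.one_left_s13]
  have hi : ρ (Extension_s13.inl f (f.toFun g h)) = f.toFun g h := DFunLike.congr_fun hρ _
  rw [← map_add, key, map_add, hi, add_sub_cancel_right]

end SymmCocycle_s13

theorem mem_RG_of_cobFree_eq_zero {x : FreeAbelianGroup (Sym2 G)} (hx : cobFree x = 0) :
    x ∈ RG G := by
  by_contra hmem
  obtain ⟨χ, hχ⟩ := CharacterModule.exists_character_apply_ne_zero_of_ne_zero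
    (a := (QuotientAddGroup.mk x : FreeAbelianGroup (Sym2 G) ⧸ RG G))
    (fun h => hmem ((QuotientAddGroup.eq_zero_iff x).1 h))
  let ψ : FreeAbelianGroup (Sym2 G) →+ AddCircle (1 : ℚ) :=
    AddMonoidHom.comp χ (QuotientAddGroup.mk' (RG G))
  let f : SymmCocycle_s13 G (AddCircle (1 : ℚ)) :=
    { toFun g h := ψ (of s(g, h))
      symm g h := by rw [Sym2.eq_swap]
      cocycle g h k := by
        have hr : ψ (of s(g, h) + of s(g * h, k) - of s(h, k) - of s(g, h * k)) = 0 := by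
          have := (QuotientAddGroup.eq_zero_iff _).2
            (AddSubgroup.subset_closure ⟨g, h, k, rfl⟩ :
              of s(g, h) + of s(g * h, k) - of s(h, k) - of s(g, h * k) ∈ RG G)
          exact (congrArg χ this).trans (map_zero χ)
        simp only [map_sub, map_add, sub_sub] at hr
        exact sub_eq_zero.1 hr }
  obtain ⟨β, hβ⟩ := f.exists_eq_coboundary (Module.Baer.of_divisible _)
  have hψ : ψ = (FreeAbelianGroup.lift β).comp cobFree := by
    ext p
    induction p using Sym2.ind with
    | _ g h => simpa [cobFree_of] using hβ g h
  apply hχ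
  change ψ x = 0
  rw [hψ, AddMonoidHom.comp_apply, hx, map_zero]

theorem exists_unit_zpow_ne_one [Infinite F] {n : ℤ} (hn : n ≠ 0) : ∃ u : Fˣ, u ^ n ≠ 1 := by
  by_contra! h
  have hN : n.natAbs ≠ 0 := Int.natAbs_ne_zero.2 hn
  have hpow (u : Fˣ) : u ^ n.natAbs = 1 := by
    rcases Int.natAbs_eq n with e | e <;> have := h u <;> rw [e] at this <;> simpa using this
  have hp : (Polynomial.X ^ (n.natAbs + 1) : Polynomial F) = Polynomial.X := by
    refine Polynomial.funext fun a => ?_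
    rcases eq_or_ne a 0 with rfl | ha
    · simp
    · have := congrArg Units.val (hpow (Units.mk0 a ha))
      simp only [Units.val_pow_eq_pow_val, Units.val_mk0, Units.val_one] at this
      simp [pow_succ, this]
  have := congrArg Polynomial.natDegree hp
  simp at this
  omega

theorem FreeAbelianGroup.eq_zero_of_forall_lift_units_eq_zero [Infinite F] {X : Type*}
    {x : FreeAbelianGroup X}
    (hx : ∀ α : X → Fˣ, FreeAbelianGroup.lift (fun i => Additive.ofMul (α i)) x = 0) :
    x = 0 := by
  classical
  apply (FreeAbelianGroup.equivFinsupp X).injective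
  rw [map_zero]
  ext i
  by_contra hn
  obtain ⟨u, hu⟩ := exists_unit_zpow_ne_one F hn
  have hcoeff : FreeAbelianGroup.lift (fun j => Additive.ofMul ((Pi.mulSingle i u : X → Fˣ) j)) =
      ((zmultiplesHom (Additive Fˣ)) (Additive.ofMul u)).comp (FreeAbelianGroup.coeff i) := by
    ext j
    rcases eq_or_ne j i with rfl | hj
    · simp [FreeAbelianGroup.coeff]
    · simp [FreeAbelianGroup.coeff, hj]
  have h0 := hx (Pi.mulSingle i u)
  rw [hcoeff] at h0
  exact hu h0

theorem character_separation [IsAlgClosed F] (S : Set (Sym2 G)) (hS : S.Finite)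
    (r : FreeAbelianGroup (Sym2 G)) (hr : r ∈ FS S) :
    (∀ α : G → Fˣ, cobU F α r = 0) ↔ r ∈ RG G ⊓ FS S := by
  simp only [cobU_eq_lift_cobFree]
  refine ⟨fun h => ⟨mem_RG_of_cobFree_eq_zero
    (FreeAbelianGroup.eq_zero_of_forall_lift_units_eq_zero F h), hr⟩, fun h α => ?_⟩
  rw [cobFree_eq_zero_of_mem_RG h.1, map_zero]
end

section
/- Let F be a field and let ε, ε': ℤ×ℤ → F be generic ℤ-graded contractions. Suppose that for every ℤ-graded Lie algebra L over F the contracted algebras L^ε and L^{ε'} are isomorphic as graded Lie algebras (i.e., via a Lie algebra isomorphism preserving each homogeneous component). Then there exists a map λ: ℤ → F^× such that ε'(m,n) = ε(m,n)·λ(m)λ(n)λ(m+n)^{-1} for all integers m ≠ n. -/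
/-!
STATEMENT 16: If `ε, ε'` are generic `ℤ`-graded contractions such that for every
`ℤ`-graded Lie algebra `L` over `F` the contracted algebras `L^ε` and `L^{ε'}` are
isomorphic as graded Lie algebras, then there exists `λ : ℤ → F^×` with
`ε'(m,n) = ε(m,n)·λ(m)λ(n)λ(m+n)⁻¹` for all integers `m ≠ n`.
-/

universe v

/-- A `ℤ`-graded Lie algebra over a field `F`. -/
structure GradedLieAlgebraZ (F : Type v) [Field F] where
  carrier : Type v
  [lieRing : LieRing carrier]
  [lieAlgebra : LieAlgebra F carrier]
  grading : ℤ → Submodule F carrier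
  internal : DirectSum.IsInternal grading
  bracket_mem : ∀ m n : ℤ, ∀ x ∈ grading m, ∀ y ∈ grading n, ⁅x, y⁆ ∈ grading (m + n)

attribute [instance] GradedLieAlgebraZ.lieRing GradedLieAlgebraZ.lieAlgebra

/-- The Lie algebra of upper triangular `3 × 3` matrices modulo scalars, in the basis
`d₁, d₂, x, y, z` with `[d₁, x] = x`, `[d₁, z] = z`, `[d₂, y] = y`, `[d₂, z] = z`, `[x, y] = z`. -/
def BorelThree (F : Type*) : Type _ := Fin 5 → F

namespace BorelThree

section LieStructure

variable {F : Type*} [CommRing F]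

instance : AddCommGroup (BorelThree F) := inferInstanceAs (AddCommGroup (Fin 5 → F))

instance : Module F (BorelThree F) := inferInstanceAs (Module F (Fin 5 → F))

@[ext] theorem ext {R : Type*} {v w : BorelThree R} (h : ∀ i, v i = w i) : v = w := funext h

@[simp] theorem zero_apply (i : Fin 5) : (0 : BorelThree F) i = 0 := rfl

@[simp] theorem add_apply (v w : BorelThree F) (i : Fin 5) : (v + w) i = v i + w i := rfl

@[simp] theorem neg_apply (v : BorelThree F) (i : Fin 5) : (-v) i = -v i := rfl

@[simp] theorem smul_apply (c : F) (v : BorelThree F) (i : Fin 5) : (c • v) i = c * v i := rfl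

instance : Bracket (BorelThree F) (BorelThree F) where
  bracket v w := ![0, 0, v 0 * w 2 - v 2 * w 0, v 1 * w 3 - v 3 * w 1,
    (v 0 + v 1) * w 4 - v 4 * (w 0 + w 1) + v 2 * w 3 - v 3 * w 2]

theorem bracket_zero (v w : BorelThree F) : ⁅v, w⁆ 0 = 0 := rfl

theorem bracket_one (v w : BorelThree F) : ⁅v, w⁆ 1 = 0 := rfl

theorem bracket_two (v w : BorelThree F) : ⁅v, w⁆ 2 = v 0 * w 2 - v 2 * w 0 := rfl

theorem bracket_three (v w : BorelThree F) : ⁅v, w⁆ 3 = v 1 * w 3 - v 3 * w 1 := rfl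

theorem bracket_four (v w : BorelThree F) :
    ⁅v, w⁆ 4 = (v 0 + v 1) * w 4 - v 4 * (w 0 + w 1) + v 2 * w 3 - v 3 * w 2 := rfl

instance : LieRing (BorelThree F) where
  add_lie u v w := by
    ext i
    fin_cases i <;> simp [bracket_zero, bracket_one, bracket_two, bracket_three, bracket_four] <;>
      ring
  lie_add u v w := by
    ext i
    fin_cases i <;> simp [bracket_zero, bracket_one, bracket_two, bracket_three, bracket_four] <;>
      ring
  lie_self v := by
    ext i
    fin_cases i <;> simp [bracket_zero, bracket_one, bracket_two, bracket_three, bracket_four] <;>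
      ring
  leibniz_lie u v w := by
    ext i
    fin_cases i <;> simp [bracket_zero, bracket_one, bracket_two, bracket_three, bracket_four] <;>
      ring

instance : LieAlgebra F (BorelThree F) where
  lie_smul c v w := by
    ext i
    fin_cases i <;> simp [bracket_zero, bracket_one, bracket_two, bracket_three, bracket_four] <;>
      ring

/-- The basis `d₁, d₂, x, y, z`. -/
def basisVec (i : Fin 5) : BorelThree F := fun j => if j = i then 1 else 0

theorem lie_basisVec_zero_two :
    ⁅(basisVec 0 : BorelThree F), (basisVec 2 : BorelThree F)⁆ = basisVec 2 := by
  ext i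
  fin_cases i <;> simp [bracket_zero, bracket_one, bracket_two, bracket_three, bracket_four,
    basisVec]

theorem lie_basisVec_zero_three :
    ⁅(basisVec 0 : BorelThree F), (basisVec 3 : BorelThree F)⁆ = 0 := by
  ext i
  fin_cases i <;> simp [bracket_zero, bracket_one, bracket_two, bracket_three, bracket_four,
    basisVec]

theorem lie_basisVec_zero_four :
    ⁅(basisVec 0 : BorelThree F), (basisVec 4 : BorelThree F)⁆ = basisVec 4 := by
  ext i
  fin_cases i <;> simp [bracket_zero, bracket_one, bracket_two, bracket_three, bracket_four,
    basisVec]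

theorem lie_basisVec_one_two :
    ⁅(basisVec 1 : BorelThree F), (basisVec 2 : BorelThree F)⁆ = 0 := by
  ext i
  fin_cases i <;> simp [bracket_zero, bracket_one, bracket_two, bracket_three, bracket_four,
    basisVec]

theorem lie_basisVec_one_three :
    ⁅(basisVec 1 : BorelThree F), (basisVec 3 : BorelThree F)⁆ = basisVec 3 := by
  ext i
  fin_cases i <;> simp [bracket_zero, bracket_one, bracket_two, bracket_three, bracket_four,
    basisVec]

theorem lie_basisVec_one_four :
    ⁅(basisVec 1 : BorelThree F), (basisVec 4 : BorelThree F)⁆ = basisVec 4 := by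
  ext i
  fin_cases i <;> simp [bracket_zero, bracket_one, bracket_two, bracket_three, bracket_four,
    basisVec]

theorem lie_basisVec_two_three :
    ⁅(basisVec 2 : BorelThree F), (basisVec 3 : BorelThree F)⁆ = basisVec 4 := by
  ext i
  fin_cases i <;> simp [bracket_zero, bracket_one, bracket_two, bracket_three, bracket_four,
    basisVec]

end LieStructure

section Autotopy

variable {F : Type*} [Field F]

/-- The determinant induced on `⟨x, y, z⟩ / ⟨z⟩` by a linear map, divided by its
eigenvalue on `z`, whenever these subspaces are preserved. -/
def scale (f : BorelThree F →ₗ[F] BorelThree F) : F :=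
  (f (basisVec 2) 2 * f (basisVec 3) 3 - f (basisVec 2) 3 * f (basisVec 3) 2) / f (basisVec 4) 4

theorem scale_smul (c : F) (f : BorelThree F →ₗ[F] BorelThree F) :
    scale (c • f) = c * scale f := by
  simp only [scale, LinearMap.smul_apply, smul_apply]
  rcases eq_or_ne c 0 with rfl | hc
  · simp
  · rw [mul_mul_mul_comm, mul_mul_mul_comm c _ c, ← mul_sub, mul_div_mul_comm,
      mul_self_div_self]

/-- The polynomial relations between matrix entries of an autotopy of `BorelThree F` that force
`scale` to be multiplicative. -/
theorem scale_mul_of_relations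
    {α₀ α₁ β₀ β₁ α₀' α₁' β₀' β₁' p₂ p₃ q₂ q₃ p₂' p₃' q₂' q₃' ζ ζ' η X₂ X₃ Y₂ Y₃ : F}
    (x23 : p₂ * p₃ = 0) (y23' : q₂' * q₃' = 0) (hζ : ζ ≠ 0) (hζ' : ζ' ≠ 0) (hη : η ≠ 0)
    (b22 : p₂ * p₃' = p₃ * p₂') (b33 : q₂ * q₃' = q₃ * q₂')
    (b23 : η = p₂ * q₃' - p₃ * q₂') (b23' : η = p₂' * q₃ - p₃' * q₂)
    (b04 : η = (α₀ + α₁) * ζ') (b04' : η = (α₀' + α₁') * ζ)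
    (b14 : η = (β₀ + β₁) * ζ') (b14' : η = (β₀' + β₁') * ζ)
    (b03₂ : α₀ * q₂' = 0) (b03₂' : α₀' * q₂ = 0) (b03₃ : α₁ * q₃' = 0) (b03₃' : α₁' * q₃ = 0)
    (b12₂ : β₀ * p₂' = 0) (b12₂' : β₀' * p₂ = 0) (b12₃ : β₁ * p₃' = 0) (b12₃' : β₁' * p₃ = 0)
    (b02₂ : X₂ = α₀ * p₂') (b02₂' : X₂ = α₀' * p₂) (b02₃ : X₃ = α₁ * p₃') (b02₃' : X₃ = α₁' * p₃)
    (b13₂ : Y₂ = β₀ * q₂') (b13₂' : Y₂ = β₀' * q₂) (b13₃ : Y₃ = β₁ * q₃') (b13₃' : Y₃ = β₁' * q₃) :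
    (p₂ * q₃ - p₃ * q₂) / ζ ≠ 0 ∧ (p₂' * q₃' - p₃' * q₂') / ζ' ≠ 0 ∧
      (X₂ * Y₃ - X₃ * Y₂) / η =
        (p₂ * q₃ - p₃ * q₂) / ζ * ((p₂' * q₃' - p₃' * q₂') / ζ') := by
  rcases mul_eq_zero.1 x23 with hp | hp
  · have h1 : p₃ ≠ 0 := by rintro rfl; simp_all
    have h2 : q₂' ≠ 0 := by rintro rfl; simp_all
    obtain rfl : q₃' = 0 := by simpa [h2] using y23'
    obtain rfl : p₂' = 0 := by simpa [hp, h1] using b22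
    obtain rfl : q₃ = 0 := by simpa [h2] using b33
    have h3 : p₃' ≠ 0 := by rintro rfl; simp_all
    have h4 : q₂ ≠ 0 := by rintro rfl; simp_all
    obtain rfl : α₀ = 0 := by simpa [h2] using b03₂
    obtain rfl : α₀' = 0 := by simpa [h4] using b03₂'
    obtain rfl : β₁ = 0 := by simpa [h3] using b12₃
    obtain rfl : β₁' = 0 := by simpa [h1] using b12₃'
    refine ⟨by simp [*], by simp [*], ?_⟩
    subst hp
    have e : q₂' * ζ = q₂ * ζ' := by
      have : β₀' ≠ 0 := by rintro rfl; simp_all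
      apply mul_left_cancel₀ (mul_ne_zero hη this)
      grind
    field_simp
    grind
  · have h1 : p₂ ≠ 0 := by rintro rfl; simp_all
    have h2 : q₃' ≠ 0 := by rintro rfl; simp_all
    obtain rfl : q₂' = 0 := by simpa [h2] using y23'
    obtain rfl : p₃' = 0 := by simpa [hp, h1] using b22
    obtain rfl : q₂ = 0 := by simpa [h2] using b33
    have h3 : p₂' ≠ 0 := by rintro rfl; simp_all
    have h4 : q₃ ≠ 0 := by rintro rfl; simp_all
    obtain rfl : α₁ = 0 := by simpa [h2] using b03₃
    obtain rfl : α₁' = 0 := by simpa [h4] using b03₃'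
    obtain rfl : β₀ = 0 := by simpa [h3] using b12₂
    obtain rfl : β₀' = 0 := by simpa [h1] using b12₂'
    refine ⟨by simp [*], by simp [*], ?_⟩
    subst hp
    have e : q₃' * ζ = q₃ * ζ' := by
      have : β₁' ≠ 0 := by rintro rfl; simp_all
      apply mul_left_cancel₀ (mul_ne_zero hη this)
      grind
    field_simp
    grind

theorem eq_zero_of_parallel {a u : BorelThree F}
    (h : ∀ w : BorelThree F, ∃ k : F, ⁅a, w⁆ = k • u) : a 0 = 0 ∧ a 1 = 0 ∧ a 2 = 0 ∧ a 3 = 0 := by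
  have key : ∀ i j : Fin 5, ∀ p q : Fin 5,
      ⁅a, (basisVec i : BorelThree F)⁆ p * ⁅a, (basisVec j : BorelThree F)⁆ q =
        ⁅a, (basisVec i : BorelThree F)⁆ q * ⁅a, (basisVec j : BorelThree F)⁆ p := by
    intro i j p q
    obtain ⟨k, hk⟩ := h (basisVec i)
    obtain ⟨l, hl⟩ := h (basisVec j)
    simp only [hk, hl, smul_apply]
    ring
  have h01 := key 2 3 2 3
  have h24 := key 2 4 2 4
  have h34 := key 3 4 3 4
  have h03 := key 0 3 2 4
  have h12 := key 1 2 3 4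
  simp [bracket_two, bracket_three, bracket_four, basisVec] at h01 h24 h34 h03 h12
  have a0 : a 0 = 0 := by grind
  have a1 : a 1 = 0 := by grind
  grind

theorem eq_zero_of_parallel_mod {a : BorelThree F} {s t : F}
    (h : ∀ w : BorelThree F, ∃ k : F, ⁅a, w⁆ 2 = k * s ∧ ⁅a, w⁆ 3 = k * t) (h01 : a 0 + a 1 = 0) :
    a 0 = 0 ∧ a 1 = 0 ∧ a 2 * a 3 = 0 := by
  have key : ∀ v w : BorelThree F, ⁅a, v⁆ 2 * ⁅a, w⁆ 3 = ⁅a, w⁆ 2 * ⁅a, v⁆ 3 := by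
    intro v w
    obtain ⟨k, hk, hk'⟩ := h v
    obtain ⟨l, hl, hl'⟩ := h w
    rw [hk, hk', hl, hl']
    ring
  have e1 := key (basisVec 2) (basisVec 3)
  have e2 := key (basisVec 0) (basisVec 1)
  simp [bracket_two, bracket_three, basisVec] at e1 e2
  grind

variable {f g h : BorelThree F →ₗ[F] BorelThree F}

theorem autotopy_symm (H : ∀ v w, h ⁅v, w⁆ = ⁅f v, g w⁆) (v w : BorelThree F) :
    h ⁅v, w⁆ = ⁅g v, f w⁆ := by
  rw [← lie_skew, map_neg, H, lie_skew]

theorem autotopy_basis_four (hg : Function.Surjective g)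
    (H : ∀ v w, h ⁅v, w⁆ = ⁅f v, g w⁆) :
    f (basisVec 4) 0 = 0 ∧ f (basisVec 4) 1 = 0 ∧ f (basisVec 4) 2 = 0 ∧ f (basisVec 4) 3 = 0 := by
  apply eq_zero_of_parallel (u := h (basisVec 4))
  intro w
  obtain ⟨w, rfl⟩ := hg w
  refine ⟨-(w 0 + w 1), ?_⟩
  rw [← H, ← map_smul]
  congr 1
  ext i
  fin_cases i <;> simp [bracket_zero, bracket_one, bracket_two, bracket_three, bracket_four,
    basisVec]

theorem autotopy_image_basis_four (hf : Function.Surjective f)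
    (H : ∀ v w, h ⁅v, w⁆ = ⁅f v, g w⁆) (i : Fin 5) (hi : i ≠ 4) : h (basisVec 4) i = 0 := by
  obtain ⟨z0, z1, z2, z3⟩ := autotopy_basis_four hf (autotopy_symm H)
  rw [← lie_basisVec_zero_four, H]
  fin_cases i <;> first
    | exact absurd rfl hi
    | simp [bracket_zero, bracket_one, bracket_two, bracket_three, z0, z1, z2, z3]

theorem autotopy_basis_four_ne_zero (hf : Function.Surjective f)
    (hh : Function.Injective h) (H : ∀ v w, h ⁅v, w⁆ = ⁅f v, g w⁆) :
    h (basisVec 4) 4 ≠ 0 := by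
  intro h4
  have hz : h (basisVec 4) = 0 := by
    ext i
    by_cases hi : i = 4
    · rw [hi, h4, zero_apply]
    · exact autotopy_image_basis_four hf H i hi
  have := congrFun (hh (hz.trans (map_zero h).symm)) 4
  simp [basisVec] at this

theorem autotopy_apply (H : ∀ v w, h ⁅v, w⁆ = ⁅f v, g w⁆) (i j : Fin 5) (u : BorelThree F)
    (hu : ⁅(basisVec i : BorelThree F), (basisVec j : BorelThree F)⁆ = u) (k : Fin 5) :
    h u k = ⁅f (basisVec i), g (basisVec j)⁆ k := by
  rw [← H, hu]

theorem autotopy_basis_four_four_ne_zero (hf : Function.Surjective f)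
    (hh : Function.Injective h) (H : ∀ v w, h ⁅v, w⁆ = ⁅f v, g w⁆) : g (basisVec 4) 4 ≠ 0 := by
  intro hz
  apply autotopy_basis_four_ne_zero hf hh H
  obtain ⟨z0, z1, z2, z3⟩ := autotopy_basis_four hf (autotopy_symm H)
  rw [autotopy_apply H 0 4 (basisVec 4) lie_basisVec_zero_four]
  simp [bracket_four, hz, z0, z1, z2, z3]

theorem autotopy_nilradical (hf : Function.Surjective f) (hg : Function.Surjective g)
    (hh : Function.Injective h) (H : ∀ v w, h ⁅v, w⁆ = ⁅f v, g w⁆) (j : Fin 5)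
    (hj : j = 2 ∨ j = 3) :
    f (basisVec j) 0 = 0 ∧ f (basisVec j) 1 = 0 ∧ f (basisVec j) 2 * f (basisVec j) 3 = 0 := by
  apply eq_zero_of_parallel_mod (s := h (basisVec j) 2) (t := h (basisVec j) 3)
  · intro w
    obtain ⟨w, rfl⟩ := hg w
    have h2 := autotopy_image_basis_four hf H 2 (by decide)
    have h3 := autotopy_image_basis_four hf H 3 (by decide)
    rw [← H]
    rcases hj with rfl | rfl
    · refine ⟨-w 0, ?_⟩
      have : ⁅(basisVec 2 : BorelThree F), w⁆ = (-w 0) • basisVec 2 + w 3 • basisVec 4 := by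
        ext i
        fin_cases i <;> simp [bracket_zero, bracket_one, bracket_two, bracket_three, bracket_four,
          basisVec]
      simp [this, h2, h3]
    · refine ⟨-w 1, ?_⟩
      have : ⁅(basisVec 3 : BorelThree F), w⁆ = (-w 1) • basisVec 3 + (-w 2) • basisVec 4 := by
        ext i
        fin_cases i <;> simp [bracket_zero, bracket_one, bracket_two, bracket_three, bracket_four,
          basisVec]
      simp [this, h2, h3]
  · obtain ⟨z0, z1, z2, z3⟩ := autotopy_basis_four hf (autotopy_symm H)
    have := autotopy_apply H j 4 0 (by
      ext k
      rcases hj with rfl | rfl <;> fin_cases k <;> simp [bracket_zero, bracket_one, bracket_two,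
        bracket_three, bracket_four, basisVec]) 4
    have hne := autotopy_basis_four_four_ne_zero hf hh H
    simpa [bracket_four, z0, z1, z2, z3, hne] using this

/-- The scale is multiplicative on autotopies. -/
theorem scale_autotopy (hf : Function.Surjective f) (hg : Function.Surjective g)
    (hh : Function.Injective h) (H : ∀ v w, h ⁅v, w⁆ = ⁅f v, g w⁆) :
    scale f ≠ 0 ∧ scale g ≠ 0 ∧ scale h = scale f * scale g := by
  have S := autotopy_symm H
  have hη := autotopy_basis_four_ne_zero hf hh H
  have hζ' := autotopy_basis_four_four_ne_zero hf hh H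
  have hζ := autotopy_basis_four_four_ne_zero hg hh S
  obtain ⟨z0, z1, z2, z3⟩ := autotopy_basis_four hg H
  obtain ⟨z0', z1', z2', z3'⟩ := autotopy_basis_four hf S
  obtain ⟨x0, x1, x23⟩ := autotopy_nilradical hf hg hh H 2 (.inl rfl)
  obtain ⟨y0, y1, y23⟩ := autotopy_nilradical hf hg hh H 3 (.inr rfl)
  obtain ⟨x0', x1', x23'⟩ := autotopy_nilradical hg hf hh S 2 (.inl rfl)
  obtain ⟨y0', y1', y23'⟩ := autotopy_nilradical hg hf hh S 3 (.inr rfl)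
  have calcBracket : ∀ i j : Fin 5, ∀ u : BorelThree F,
      ⁅(basisVec i : BorelThree F), (basisVec j : BorelThree F)⁆ = u →
      ∀ k, h u k = ⁅f (basisVec i), g (basisVec j)⁆ k ∧
        h u k = ⁅g (basisVec i), f (basisVec j)⁆ k :=
    fun i j u hu k => ⟨autotopy_apply H i j u hu k, autotopy_apply S i j u hu k⟩
  have b04 := calcBracket 0 4 (basisVec 4) lie_basisVec_zero_four 4
  have b14 := calcBracket 1 4 (basisVec 4) lie_basisVec_one_four 4
  have b23 := calcBracket 2 3 (basisVec 4) lie_basisVec_two_three 4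
  have b22 := calcBracket 2 2 0 (by simp) 4
  have b33 := calcBracket 3 3 0 (by simp) 4
  have b02 := calcBracket 0 2 (basisVec 2) lie_basisVec_zero_two
  have b13 := calcBracket 1 3 (basisVec 3) lie_basisVec_one_three
  have b03 := calcBracket 0 3 0 lie_basisVec_zero_three
  have b12 := calcBracket 1 2 0 lie_basisVec_one_two
  have b02₂ := b02 2
  have b02₃ := b02 3
  have b13₂ := b13 2
  have b13₃ := b13 3
  have b03₂ := b03 2
  have b03₃ := b03 3
  have b12₂ := b12 2
  have b12₃ := b12 3
  simp only [bracket_two, bracket_three, bracket_four, x0, x1, y0, y1, x0', x1', y0', y1', z0, z1,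
    z2, z3, z0', z1', z2', z3', map_zero, zero_apply, mul_zero, zero_mul, sub_zero, add_zero,
    zero_add] at b04 b14 b23 b22 b33 b02₂ b02₃ b13₂ b13₃ b03₂ b03₃ b12₂ b12₃
  exact scale_mul_of_relations x23 y23' hζ hζ' hη (sub_eq_zero.1 b22.1.symm) (sub_eq_zero.1 b33.1.symm)
    b23.1 b23.2 b04.1 b04.2 b14.1 b14.2 b03₂.1.symm b03₂.2.symm b03₃.1.symm b03₃.2.symm
    b12₂.1.symm b12₂.2.symm b12₃.1.symm b12₃.2.symm b02₂.1 b02₂.2 b02₃.1 b02₃.2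
    b13₂.1 b13₂.2 b13₃.1 b13₃.2

end Autotopy

end BorelThree

/-- The bilinear map on finitely supported functions `ℤ →₀ V` (regarded as Laurent polynomials
with coefficients in `V`) that extends `(v tᵐ, w tⁿ) ↦ ε(m, n) β(v, w) tᵐ⁺ⁿ`. -/
noncomputable def loopBilin {F V : Type*} [CommRing F] [AddCommGroup V] [Module F V]
    (ε : ℤ → ℤ → F) (β : V →ₗ[F] V →ₗ[F] V) : (ℤ →₀ V) →ₗ[F] (ℤ →₀ V) →ₗ[F] (ℤ →₀ V) :=
  Finsupp.lsum F fun m => LinearMap.flip (Finsupp.lsum F fun n =>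
    (β.compr₂ (ε m n • Finsupp.lsingle (m + n))).flip)

@[simp] theorem loopBilin_single {F V : Type*} [CommRing F] [AddCommGroup V] [Module F V]
    (ε : ℤ → ℤ → F) (β : V →ₗ[F] V →ₗ[F] V) (m n : ℤ) (v w : V) :
    loopBilin ε β (Finsupp.single m v) (Finsupp.single n w) =
      ε m n • Finsupp.single (m + n) (β v w) := by
  simp [loopBilin]

/-- The loop algebra of a Lie algebra. -/
def LoopAlgebra (V : Type*) [AddCommGroup V] : Type _ := ℤ →₀ V

namespace LoopAlgebra

variable {F V : Type*} [Field F] [LieRing V] [LieAlgebra F V]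

noncomputable instance : AddCommGroup (LoopAlgebra V) := inferInstanceAs (AddCommGroup (ℤ →₀ V))

noncomputable instance : Module F (LoopAlgebra V) := inferInstanceAs (Module F (ℤ →₀ V))

variable (F V) in
/-- The bracket of the loop algebra, contracted by `ε`. -/
noncomputable def contractedBracket (ε : ℤ → ℤ → F) :
    LoopAlgebra V →ₗ[F] LoopAlgebra V →ₗ[F] LoopAlgebra V :=
  loopBilin ε (LieModule.toEnd F V V : V →ₗ[F] V →ₗ[F] V)

variable (F V) in
/-- The inclusion of the component of degree `n`. -/
noncomputable def monomial (n : ℤ) : V →ₗ[F] LoopAlgebra V := Finsupp.lsingle n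

variable (F V) in
/-- The coefficient of degree `n`. -/
noncomputable def coeff (n : ℤ) : LoopAlgebra V →ₗ[F] V := Finsupp.lapply n

@[simp] theorem coeff_monomial_self (n : ℤ) (v : V) : coeff F V n (monomial F V n v) = v :=
  Finsupp.single_eq_same

theorem contractedBracket_monomial (ε : ℤ → ℤ → F) (m n : ℤ) (v w : V) :
    contractedBracket F V ε (monomial F V m v) (monomial F V n w) =
      ε m n • monomial F V (m + n) ⁅v, w⁆ :=
  loopBilin_single ε _ m n v w

theorem induction_linear (F : Type*) {V : Type*} [Field F] [LieRing V] [LieAlgebra F V]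
    {p : LoopAlgebra V → Prop} (a : LoopAlgebra V) (zero : p 0)
    (add : ∀ x y, p x → p y → p (x + y)) (mono : ∀ n v, p (monomial F V n v)) : p a :=
  Finsupp.induction_linear a zero add mono

theorem hom_ext {W : Type*} [AddCommGroup W] [Module F W] {f g : LoopAlgebra V →ₗ[F] W}
    (h : ∀ n v, f (monomial F V n v) = g (monomial F V n v)) : f = g :=
  Finsupp.lhom_ext h

theorem hom_ext₂ {W : Type*} [AddCommGroup W] [Module F W]
    {f g : LoopAlgebra V →ₗ[F] LoopAlgebra V →ₗ[F] W}
    (h : ∀ m v n w, f (monomial F V m v) (monomial F V n w) =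
      g (monomial F V m v) (monomial F V n w)) : f = g :=
  hom_ext fun m v => hom_ext fun n w => h m v n w

variable (F V) in
theorem contractedBracket_one_self (a : LoopAlgebra V) :
    contractedBracket F V (fun _ _ => 1) a a = 0 := by
  have skew : contractedBracket F V (fun _ _ => 1) =
      -(contractedBracket F V (fun _ _ => 1)).flip := by
    refine hom_ext₂ fun m v n w => ?_
    rw [LinearMap.neg_apply, LinearMap.neg_apply, LinearMap.flip_apply,
      contractedBracket_monomial, contractedBracket_monomial, ← lie_skew, map_neg, add_comm,
      smul_neg]
  refine induction_linear F (p := fun a => contractedBracket F V (fun _ _ => 1) a a = 0) a ?_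
    (fun x y hx hy => ?_) fun m v => ?_
  · exact map_zero _
  · have hxy := LinearMap.congr_fun₂ skew x y
    rw [LinearMap.neg_apply, LinearMap.neg_apply, LinearMap.flip_apply] at hxy
    rw [map_add, map_add, LinearMap.add_apply, LinearMap.add_apply, hx, hy, hxy]
    abel
  · rw [contractedBracket_monomial, lie_self, map_zero, smul_zero]

variable (F V) in
theorem contractedBracket_one_leibniz (a b c : LoopAlgebra V) :
    contractedBracket F V (fun _ _ => 1) a (contractedBracket F V (fun _ _ => 1) b c) =
      contractedBracket F V (fun _ _ => 1) (contractedBracket F V (fun _ _ => 1) a b) c +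
      contractedBracket F V (fun _ _ => 1) b (contractedBracket F V (fun _ _ => 1) a c) := by
  set B := contractedBracket F V (fun _ _ => 1) with hB
  have hmono : ∀ m u n v k w, B (monomial F V m u) (B (monomial F V n v) (monomial F V k w)) =
      B (B (monomial F V m u) (monomial F V n v)) (monomial F V k w) +
        B (monomial F V n v) (B (monomial F V m u) (monomial F V k w)) := by
    intro m u n v k w
    have hB' : ∀ (m n : ℤ) (v w : V), B (monomial F V m v) (monomial F V n w) =
        monomial F V (m + n) ⁅v, w⁆ := fun m n v w => by
      rw [hB, contractedBracket_monomial, one_smul]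
    rw [hB', hB', hB', hB', hB', hB', leibniz_lie, map_add, add_assoc m n k, add_left_comm n m k]
  have hc : ∀ m u n v, B (monomial F V m u) ∘ₗ B (monomial F V n v) =
      B (B (monomial F V m u) (monomial F V n v)) +
        B (monomial F V n v) ∘ₗ B (monomial F V m u) :=
    fun m u n v => hom_ext fun k w => hmono m u n v k w
  have hb : ∀ m u, B (monomial F V m u) ∘ₗ B.flip c =
      B.flip c ∘ₗ B (monomial F V m u) + B.flip (B (monomial F V m u) c) :=
    fun m u => hom_ext fun n v => LinearMap.congr_fun (hc m u n v) c
  have ha : B.flip (B b c) = B.flip c ∘ₗ B.flip b + B b ∘ₗ B.flip c :=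
    hom_ext fun m u => LinearMap.congr_fun (hb m u) b
  exact LinearMap.congr_fun ha a

variable (F V) in
/-- The Lie ring structure on the loop algebra. -/
noncomputable abbrev lieRing : LieRing (LoopAlgebra V) where
  bracket a b := contractedBracket F V (fun _ _ => 1) a b
  add_lie a b c := by simp
  lie_add a b c := by simp
  lie_self a := contractedBracket_one_self F V a
  leibniz_lie a b c := contractedBracket_one_leibniz F V a b c

theorem monomial_isInternal :
    DirectSum.IsInternal fun n : ℤ => LinearMap.range (monomial F V n) := by
  classical
  rw [DirectSum.isInternal_submodule_iff_iSupIndep_and_iSup_eq_top]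
  constructor
  · rw [iSupIndep_def]
    intro n
    rw [Submodule.disjoint_def]
    rintro _ ⟨v, rfl⟩ hv
    have hker : (⨆ (j : ℤ) (_ : j ≠ n), LinearMap.range (monomial F V j)) ≤
        LinearMap.ker (coeff F V n) := by
      refine iSup₂_le fun j hj => ?_
      rintro _ ⟨w, rfl⟩
      exact Finsupp.single_eq_of_ne hj.symm
    have := hker hv
    rw [LinearMap.mem_ker, coeff_monomial_self] at this
    rw [this, map_zero]
  · rw [eq_top_iff]
    rintro a -
    exact induction_linear F a (zero_mem _) (fun x y hx hy => add_mem hx hy)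
      fun n v => Submodule.mem_iSup_of_mem n ⟨v, rfl⟩

end LoopAlgebra

/-- The loop algebra as a `ℤ`-graded Lie algebra. -/
noncomputable def loopGraded (F V : Type v) [Field F] [LieRing V] [LieAlgebra F V] :
    GradedLieAlgebraZ F :=
  letI := LoopAlgebra.lieRing F V
  { carrier := LoopAlgebra V
    lieRing := LoopAlgebra.lieRing F V
    lieAlgebra :=
      { (inferInstance : Module F (LoopAlgebra V)) with
        lie_smul := fun c a b => map_smul (LoopAlgebra.contractedBracket F V (fun _ _ => 1) a) c b }
    grading := fun n => LinearMap.range (LoopAlgebra.monomial F V n)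
    internal := LoopAlgebra.monomial_isInternal
    bracket_mem := by
      rintro m n _ ⟨v, rfl⟩ _ ⟨w, rfl⟩
      refine ⟨⁅v, w⁆, ?_⟩
      exact ((LoopAlgebra.contractedBracket_monomial (fun _ _ => (1 : F)) m n v w).trans
        (one_smul _ _)).symm }

/-- Isomorphisms between the two contractions of a loop algebra amount to a family of autotopies
of the coefficient Lie algebra, up to scalars. -/
theorem loop_autotopy {F V : Type v} [Field F] [LieRing V] [LieAlgebra F V]
    {ε ε' : ℤ → ℤ → F}
    (H : ∀ (L : GradedLieAlgebraZ F)
        (bε bε' : L.carrier →ₗ[F] L.carrier →ₗ[F] L.carrier),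
        (∀ m n : ℤ, ∀ x ∈ L.grading m, ∀ y ∈ L.grading n, bε x y = ε m n • ⁅x, y⁆) →
        (∀ m n : ℤ, ∀ x ∈ L.grading m, ∀ y ∈ L.grading n, bε' x y = ε' m n • ⁅x, y⁆) →
        ∃ φ : L.carrier ≃ₗ[F] L.carrier,
          (∀ n : ℤ, Submodule.map (φ : L.carrier →ₗ[F] L.carrier) (L.grading n) =
            L.grading n) ∧
          ∀ x y : L.carrier, φ (bε x y) = bε' (φ x) (φ y)) :
    ∃ f : ℤ → V →ₗ[F] V, (∀ n, Function.Bijective (f n)) ∧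
      ∀ m n v w, ε m n • f (m + n) ⁅v, w⁆ = ε' m n • ⁅f m v, f n w⁆ := by
  have bracket_eq : ∀ δ : ℤ → ℤ → F, ∀ m n : ℤ, ∀ x ∈ (loopGraded F V).grading m,
      ∀ y ∈ (loopGraded F V).grading n,
      LoopAlgebra.contractedBracket F V δ x y = δ m n • (⁅x, y⁆ : (loopGraded F V).carrier) := by
    rintro δ m n _ ⟨v, rfl⟩ _ ⟨w, rfl⟩
    refine (LoopAlgebra.contractedBracket_monomial δ m n v w).trans ?_
    exact congrArg (δ m n • ·)
      ((LoopAlgebra.contractedBracket_monomial (fun _ _ => (1 : F)) m n v w).trans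
        (one_smul _ _)).symm
  obtain ⟨φ, hφ, hmul⟩ := H (loopGraded F V) (LoopAlgebra.contractedBracket F V ε)
    (LoopAlgebra.contractedBracket F V ε') (bracket_eq ε) (bracket_eq ε')
  change LoopAlgebra V ≃ₗ[F] LoopAlgebra V at φ
  change ∀ n, Submodule.map (φ : LoopAlgebra V →ₗ[F] LoopAlgebra V)
    (LinearMap.range (LoopAlgebra.monomial F V n)) =
      LinearMap.range (LoopAlgebra.monomial F V n) at hφ
  change ∀ x y : LoopAlgebra V, φ (LoopAlgebra.contractedBracket F V ε x y) =
    LoopAlgebra.contractedBracket F V ε' (φ x) (φ y) at hmul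
  have φ_monomial : ∀ n v, φ (LoopAlgebra.monomial F V n v) = LoopAlgebra.monomial F V n
      (LoopAlgebra.coeff F V n (φ (LoopAlgebra.monomial F V n v))) := by
    intro n v
    obtain ⟨w, hw⟩ := (hφ n).le ⟨_, ⟨v, rfl⟩, rfl⟩
    change _ = φ _ at hw
    rw [← hw, LoopAlgebra.coeff_monomial_self]
  refine ⟨fun n => LoopAlgebra.coeff F V n ∘ₗ (φ : LoopAlgebra V →ₗ[F] LoopAlgebra V) ∘ₗ
    LoopAlgebra.monomial F V n, fun n => ⟨?_, ?_⟩, ?_⟩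
  · intro v w hvw
    change LoopAlgebra.coeff F V n (φ (LoopAlgebra.monomial F V n v)) =
      LoopAlgebra.coeff F V n (φ (LoopAlgebra.monomial F V n w)) at hvw
    have := φ_monomial n v
    rw [hvw, ← φ_monomial n w] at this
    simpa using congrArg (LoopAlgebra.coeff F V n) (φ.injective this)
  · intro w
    obtain ⟨_, ⟨v, rfl⟩, hv⟩ := (hφ n).ge ⟨w, rfl⟩
    refine ⟨v, ?_⟩
    change φ _ = _ at hv
    simp [hv]
  · intro m n v w
    have := hmul (LoopAlgebra.monomial F V m v) (LoopAlgebra.monomial F V n w)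
    rw [φ_monomial m v, φ_monomial n w, LoopAlgebra.contractedBracket_monomial,
      LoopAlgebra.contractedBracket_monomial, map_smul] at this
    simpa using congrArg (LoopAlgebra.coeff F V (m + n)) this

/-- The hypothesis `H` says that for every `ℤ`-graded Lie algebra `L`
and the brackets `bε`, `bε'` of the contracted algebras `L^ε`, `L^{ε'}` (the unique
bilinear maps acting as `ε m n • ⁅·,·⁆`, resp. `ε' m n • ⁅·,·⁆`, on homogeneous
elements), there is a linear automorphism `φ` of `L` preserving every homogeneous
component and intertwining the two contracted brackets, i.e. `L^ε` and `L^{ε'}` are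
isomorphic as graded Lie algebras. -/
theorem weimar_woods_for_Z (F : Type v) [Field F] (ε ε' : ℤ → ℤ → F)
    (hsym : ∀ m n : ℤ, ε m n = ε n m)
    (hcoc : ∀ m n k : ℤ, ε m (n + k) * ε n k = ε k (m + n) * ε m n)
    (hsym' : ∀ m n : ℤ, ε' m n = ε' n m)
    (hcoc' : ∀ m n k : ℤ, ε' m (n + k) * ε' n k = ε' k (m + n) * ε' m n)
    (H : ∀ (L : GradedLieAlgebraZ F)
        (bε bε' : L.carrier →ₗ[F] L.carrier →ₗ[F] L.carrier),
        (∀ m n : ℤ, ∀ x ∈ L.grading m, ∀ y ∈ L.grading n, bε x y = ε m n • ⁅x, y⁆) →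
        (∀ m n : ℤ, ∀ x ∈ L.grading m, ∀ y ∈ L.grading n, bε' x y = ε' m n • ⁅x, y⁆) →
        ∃ φ : L.carrier ≃ₗ[F] L.carrier,
          (∀ n : ℤ, Submodule.map (φ : L.carrier →ₗ[F] L.carrier) (L.grading n) =
            L.grading n) ∧
          ∀ x y : L.carrier, φ (bε x y) = bε' (φ x) (φ y)) :
    ∃ lam : ℤ → Fˣ, ∀ m n : ℤ, m ≠ n →
      ε' m n = ε m n * (lam m : F) * (lam n : F) * ((lam (m + n) : F))⁻¹ := by
  obtain ⟨f, hf, hmul⟩ := loop_autotopy (V := BorelThree F) H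
  have hne : (BorelThree.basisVec 2 : BorelThree F) ≠ 0 := fun h => by
    simpa [BorelThree.basisVec] using congrFun h 2
  classical
  refine ⟨fun n => if h : BorelThree.scale (f n) = 0 then 1 else (Units.mk0 _ h)⁻¹,
    fun m n _ => ?_⟩
  by_cases hε : ε m n = 0
  · obtain ⟨v, hv⟩ := (hf m).2 (BorelThree.basisVec 0)
    obtain ⟨w, hw⟩ := (hf n).2 (BorelThree.basisVec 2)
    have := hmul m n v w
    rw [hε, zero_smul, hv, hw, BorelThree.lie_basisVec_zero_two, eq_comm, smul_eq_zero] at this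
    rw [hε, this.resolve_right hne]
    ring
  · have hε' : ε' m n ≠ 0 := by
      intro h0
      have := hmul m n (BorelThree.basisVec 0) (BorelThree.basisVec 2)
      rw [h0, zero_smul, BorelThree.lie_basisVec_zero_two, smul_eq_zero,
        map_eq_zero_iff _ (hf _).1] at this
      exact this.elim hε hne
    obtain ⟨hm, hn, hmn⟩ := BorelThree.scale_autotopy (h := (ε m n / ε' m n) • f (m + n))
      (hf m).2 (hf n).2
      (fun v w hvw => (hf (m + n)).1 (smul_right_injective _ (div_ne_zero hε hε') hvw))
      (fun v w => by
        rw [LinearMap.smul_apply, div_eq_inv_mul, mul_smul, hmul, inv_smul_smul₀ hε'])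
    rw [BorelThree.scale_smul] at hmn
    have hs : BorelThree.scale (f (m + n)) ≠ 0 := by
      intro h0
      rw [h0, mul_zero, eq_comm, mul_eq_zero] at hmn
      exact hmn.elim hm hn
    simp only [hm, hn, hs, dite_false, Units.val_inv_eq_inv_val,
      Units.val_mk0, inv_inv]
    field_simp at hmn ⊢
    rw [← hmn]
end

section
/- Let G be an abelian group, F a field, and S ∈ S(G) (i.e., S ⊆ P_G satisfies: {g,h} ∈ S and {gh,k} ∈ S imply {h,k} ∈ S and {g,hk} ∈ S, for all g,h,k ∈ G). Then the map sending a group homomorphism γ: F_S/⟨R_S⟩ → F^× to the function ε: G×G → F defined by ε(g,h) := γ({g,h}·⟨R_S⟩) if {g,h} ∈ S and ε(g,h) := 0 otherwise, is a bijection from Hom(F_S/⟨R_S⟩, F^×) onto the set of generic G-graded contractions with support exactly S. -/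
/-!
STATEMENT 19: For `S ∈ S(G)` (a subset of `P_G` closed under the support condition),
the map sending a homomorphism `γ : F_S/⟨R_S⟩ → F^×` to the function `ε : G × G → F`
with `ε(g,h) = γ({g,h}·⟨R_S⟩)` for `{g,h} ∈ S` and `ε(g,h) = 0` otherwise is a
bijection from `Hom(F_S/⟨R_S⟩, F^×)` onto the set of generic `G`-graded contractions
with support exactly `S`.
(`F_G` and its subgroups are written additively; `F^×` is `Additive Fˣ`.)
-/

universe u v

open FreeAbelianGroup

variable (G : Type u) [CommGroup G]

variable {G}

/-- The subgroup `⟨R_S⟩` generated by the surviving defining relators `R_S = R_G ∩ F_S`. -/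
def RS (S : Set (Sym2 G)) : AddSubgroup (FreeAbelianGroup (Sym2 G)) :=
  AddSubgroup.closure (relatorSet G ∩ (FS S : Set (FreeAbelianGroup (Sym2 G))))

/-- `Z_S := F_S/⟨R_S⟩`. -/
abbrev ZS (S : Set (Sym2 G)) :=
  ↥(FS S) ⧸ (RS S).addSubgroupOf (FS S)

variable (F : Type v) [Field F]

/-- The map sending `γ : F_S/⟨R_S⟩ → F^×` to the function `ε : G × G → F` defined by
`ε(g,h) = γ({g,h}·⟨R_S⟩)` if `{g,h} ∈ S` and `ε(g,h) = 0` otherwise. -/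
noncomputable def contractionOfChar (S : Set (Sym2 G)) [DecidablePred (· ∈ S)]
    (γ : ZS S →+ Additive Fˣ) : G → G → F :=
  fun g h =>
    if hs : s(g, h) ∈ S then
      ((Additive.toMul (γ (QuotientAddGroup.mk
        (⟨of s(g, h), AddSubgroup.subset_closure (Set.mem_image_of_mem of hs)⟩ :
          ↥(FS S)))) : Fˣ) : F)
    else 0

theorem lift_eq_zero_of_mem_FS {X A : Type*} [AddCommGroup A] {S : Set (Sym2 X)}
    {f : Sym2 X → A} (hf : ∀ p ∈ S, f p = 0) {x : FreeAbelianGroup (Sym2 X)}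
    (hx : x ∈ FS S) : FreeAbelianGroup.lift f x = 0 := by
  have h : FS S ≤ (FreeAbelianGroup.lift f).ker := by
    refine (AddSubgroup.closure_le _).2 ?_
    rintro _ ⟨p, hp, rfl⟩
    simpa using hf p hp
  exact h hx

open Classical in
/-- Coefficients outside `S` of an element of `F_S` vanish; here for a four-term element. -/
theorem coeff_eq_zero_of_mem_FS {X : Type*} {S : Set (Sym2 X)} {a b c d p : Sym2 X}
    (h : of a + of b - of c - of d ∈ FS S) (hp : p ∉ S) :
    (if a = p then 1 else 0) + (if b = p then 1 else 0) - (if c = p then 1 else 0)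
      - (if d = p then 1 else 0) = (0 : ℤ) := by
  have := lift_eq_zero_of_mem_FS (f := fun q : Sym2 X => if q = p then (1 : ℤ) else 0)
    (fun q hq => if_neg fun (e : q = p) => hp (e ▸ hq)) h
  simpa using this

theorem mem_of_mem_FS_of_ne {X : Type*} {S : Set (Sym2 X)} {a b c d : Sym2 X}
    (h : of a + of b - of c - of d ∈ FS S)
    (hac : a ≠ c) (had : a ≠ d) (hbc : b ≠ c) (hbd : b ≠ d) :
    a ∈ S ∧ b ∈ S ∧ c ∈ S ∧ d ∈ S := by
  refine ⟨?_, ?_, ?_, ?_⟩ <;>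
  · by_contra hp
    have := coeff_eq_zero_of_mem_FS h hp
    simp only [if_true, hac, had, hbc, hbd, hac.symm, had.symm, hbc.symm, hbd.symm,
      if_false] at this
    split_ifs at this <;> omega

theorem eq_or_mem_of_sub_mem_FS {X : Type*} {S : Set (Sym2 X)} {a b : Sym2 X}
    (h : of a - of b ∈ FS S) : a = b ∨ a ∈ S ∧ b ∈ S := by
  by_cases hab : a = b
  · exact Or.inl hab
  have h' : of a + of a - of b - of b ∈ FS S := by
    have := (FS S).add_mem h h
    convert this using 1
    abel
  obtain ⟨ha, -, hb, -⟩ := mem_of_mem_FS_of_ne h' hab hab hab hab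
  exact Or.inr ⟨ha, hb⟩

/-- A function on pairs that satisfies the relations all of whose terms lie in `S`
satisfies every relation of `R_S`, including those with cancelling terms outside `S`. -/
theorem lift_eq_zero_of_mem_RS {A : Type*} [AddCommGroup A] {S : Set (Sym2 G)}
    (hSG : ∀ g h k : G, s(g, h) ∈ S → s(g * h, k) ∈ S → s(h, k) ∈ S ∧ s(g, h * k) ∈ S)
    {u : Sym2 G → A}
    (hu : ∀ g h k : G, s(g, h) ∈ S → s(g * h, k) ∈ S → s(h, k) ∈ S → s(g, h * k) ∈ S →
      u s(g, h) + u s(g * h, k) = u s(h, k) + u s(g, h * k))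
    {x : FreeAbelianGroup (Sym2 G)} (hx : x ∈ RS S) : FreeAbelianGroup.lift u x = 0 := by
  have hone : ∀ g : G, s(g, 1) ∈ S → u s(g, 1) = u s(1, 1) := by
    intro g hg
    have h11 : s((1 : G), 1) ∈ S := (hSG g 1 1 hg (by simpa using hg)).1
    have := hu g 1 1 hg (by simpa using hg) h11 (by simpa using hg)
    simpa using this
  have hpair : ∀ g h : G, of s(g, 1) - of s(h, 1) ∈ FS S → u s(g, 1) = u s(h, 1) := by
    intro g h hgh
    rcases eq_or_mem_of_sub_mem_FS hgh with e | ⟨hg, hh⟩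
    · rw [e]
    · rw [hone g hg, hone h hh]
  have hle : RS S ≤ (FreeAbelianGroup.lift u).ker := by
    refine (AddSubgroup.closure_le _).2 ?_
    rintro _ ⟨⟨g, h, k, rfl⟩, hmem⟩
    rw [SetLike.mem_coe] at hmem
    simp only [SetLike.mem_coe, AddMonoidHom.mem_ker, map_sub, map_add, lift_apply_of]
    by_cases hgk : g = k
    · subst hgk
      rw [Sym2.eq_swap (a := h), mul_comm h g, Sym2.eq_swap (a := g * h)]
      abel
    by_cases hk : k = 1
    · subst hk
      have := hpair (g * h) h (by convert hmem using 1; rw [mul_one]; abel)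
      rw [mul_one, this]
      abel
    by_cases hg : g = 1
    · subst hg
      have := hpair h (h * k) (by
        convert hmem using 1
        rw [one_mul, Sym2.eq_swap (a := 1), Sym2.eq_swap (a := 1)]
        abel)
      rw [one_mul, Sym2.eq_swap (a := 1), Sym2.eq_swap (a := 1), this]
      abel
    by_cases hh : h = 1
    · subst hh
      have := hpair g k (by
        convert hmem using 1
        rw [one_mul, mul_one, Sym2.eq_swap (a := 1)]
        abel)
      rw [one_mul, mul_one, Sym2.eq_swap (a := 1), this]
      abel
    obtain ⟨h1, h2, h3, h4⟩ := mem_of_mem_FS_of_ne hmem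
      (by
        rw [Ne, Sym2.eq_iff]
        rintro (⟨e₁, e₂⟩ | ⟨e₁, -⟩)
        exacts [hgk (e₁.trans e₂), hgk e₁])
      (by
        rw [Ne, Sym2.eq_iff]
        rintro (⟨-, e₂⟩ | ⟨e₁, e₂⟩)
        exacts [hk (left_eq_mul.1 e₂), hk (left_eq_mul.1 (e₂.trans e₁))])
      (by
        rw [Ne, Sym2.eq_iff]
        rintro (⟨e₁, -⟩ | ⟨e₁, e₂⟩)
        exacts [hg (mul_eq_right.1 e₁), hg (mul_eq_right.1 (e₁.trans e₂))])
      (by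
        rw [Ne, Sym2.eq_iff]
        rintro (⟨e₁, -⟩ | ⟨-, e₂⟩)
        exacts [hh (mul_eq_left.1 e₁), hgk e₂.symm])
    rw [hu g h k h1 h2 h3 h4]
    abel
  exact hle hx

/-- The class `{g,h}·⟨R_S⟩` of an element of `S` in `Z_S`. -/
def ZS.mkOf {S : Set (Sym2 G)} (p : Sym2 G) (hp : p ∈ S) : ZS S :=
  QuotientAddGroup.mk
    (⟨of p, AddSubgroup.subset_closure (Set.mem_image_of_mem of hp)⟩ : ↥(FS S))

theorem ZS.mkOf_relation {S : Set (Sym2 G)} {g h k : G} (h1 : s(g, h) ∈ S)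
    (h2 : s(g * h, k) ∈ S) (h3 : s(h, k) ∈ S) (h4 : s(g, h * k) ∈ S) :
    ZS.mkOf _ h4 + ZS.mkOf _ h3 = ZS.mkOf _ h2 + ZS.mkOf _ h1 := by
  have hmem {p : Sym2 G} (hp : p ∈ S) : of p ∈ FS S :=
    AddSubgroup.subset_closure (Set.mem_image_of_mem of hp)
  refine (QuotientAddGroup.eq (s := (RS S).addSubgroupOf (FS S))
    (a := ⟨of s(g, h * k), hmem h4⟩ + ⟨of s(h, k), hmem h3⟩)
    (b := ⟨of s(g * h, k), hmem h2⟩ + ⟨of s(g, h), hmem h1⟩)).2 ?_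
  rw [AddSubgroup.mem_addSubgroupOf]
  refine AddSubgroup.subset_closure ⟨⟨g, h, k, ?_⟩, SetLike.coe_mem _⟩
  simp only [AddSubgroup.coe_add, AddSubgroup.coe_neg]
  abel

theorem ZS.hom_ext {A : Type*} [AddCommGroup A] {S : Set (Sym2 G)} {γ δ : ZS S →+ A}
    (h : ∀ p (hp : p ∈ S), γ (ZS.mkOf p hp) = δ (ZS.mkOf p hp)) : γ = δ := by
  refine QuotientAddGroup.addMonoidHom_ext _ (AddMonoidHom.ext ?_)
  rintro ⟨x, hx⟩
  induction hx using AddSubgroup.closure_induction with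
  | mem y hy =>
    obtain ⟨p, hp, rfl⟩ := hy
    exact h p hp
  | zero => exact (map_zero _).trans (map_zero _).symm
  | add y z hy hz ihy ihz =>
    have e : (⟨y + z, (FS S).add_mem hy hz⟩ : FS S) = ⟨y, hy⟩ + ⟨z, hz⟩ := rfl
    exact (congrArg _ e).trans ((map_add _ _ _).trans
      ((congrArg₂ _ ihy ihz).trans (map_add _ _ _).symm))
  | neg y hy ih =>
    have e : (⟨-y, (FS S).neg_mem hy⟩ : FS S) = -⟨y, hy⟩ := rfl
    exact (congrArg _ e).trans ((map_neg _ _).trans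
      ((congrArg _ ih).trans (map_neg _ _).symm))

variable {F} in
theorem contractionOfChar_of_mem {S : Set (Sym2 G)} [DecidablePred (· ∈ S)]
    (γ : ZS S →+ Additive Fˣ) {g h : G} (hs : s(g, h) ∈ S) :
    contractionOfChar F S γ g h = ((γ (ZS.mkOf _ hs)).toMul : Fˣ) :=
  dif_pos hs

variable {F} in
theorem contractionOfChar_of_notMem {S : Set (Sym2 G)} [DecidablePred (· ∈ S)]
    (γ : ZS S →+ Additive Fˣ) {g h : G} (hs : s(g, h) ∉ S) :
    contractionOfChar F S γ g h = 0 :=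
  dif_neg hs

variable {F} in
theorem contractionOfChar_ne_zero_iff {S : Set (Sym2 G)} [DecidablePred (· ∈ S)]
    (γ : ZS S →+ Additive Fˣ) (g h : G) :
    contractionOfChar F S γ g h ≠ 0 ↔ s(g, h) ∈ S := by
  by_cases hs : s(g, h) ∈ S
  · simp [contractionOfChar_of_mem γ hs, hs]
  · simp [contractionOfChar_of_notMem γ hs, hs]

variable {F} in
theorem contractionOfChar_symm {S : Set (Sym2 G)} [DecidablePred (· ∈ S)]
    (γ : ZS S →+ Additive Fˣ) (g h : G) :
    contractionOfChar F S γ g h = contractionOfChar F S γ h g := by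
  simp only [contractionOfChar, Sym2.eq_swap (a := g)]

/-- STATEMENT 19.  The hypothesis `hSG` says `S ∈ S(G)`.  The target set is the set of
generic `G`-graded contractions with support exactly `S`. -/
theorem char_bijection_onto_contractions_with_support (S : Set (Sym2 G))
    [DecidablePred (· ∈ S)]
    (hSG : ∀ g h k : G, s(g, h) ∈ S → s(g * h, k) ∈ S → s(h, k) ∈ S ∧ s(g, h * k) ∈ S) :
    Set.BijOn (contractionOfChar F S) Set.univ
      {ε : G → G → F |
        (∀ g h : G, ε g h = ε h g) ∧
        (∀ g h k : G, ε g (h * k) * ε h k = ε k (g * h) * ε g h) ∧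
        (∀ g h : G, ε g h ≠ 0 ↔ s(g, h) ∈ S)} := by
  refine ⟨?_, ?_, ?_⟩
  · intro γ _
    refine ⟨contractionOfChar_symm γ, fun g h k => ?_, contractionOfChar_ne_zero_iff γ⟩
    rw [contractionOfChar_symm γ k]
    by_cases hs : s(g, h) ∈ S ∧ s(g * h, k) ∈ S
    · obtain ⟨h1, h2⟩ := hs
      obtain ⟨h3, h4⟩ := hSG g h k h1 h2
      rw [contractionOfChar_of_mem γ h1, contractionOfChar_of_mem γ h2,
        contractionOfChar_of_mem γ h3, contractionOfChar_of_mem γ h4, ← Units.val_mul,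
        ← Units.val_mul, ← toMul_add, ← toMul_add, ← map_add, ← map_add,
        ZS.mkOf_relation h1 h2 h3 h4]
    · have hs' : ¬ (s(h, k) ∈ S ∧ s(g, h * k) ∈ S) := by
        rintro ⟨h3, h4⟩
        rw [Sym2.eq_swap] at h3 h4
        rw [mul_comm h k] at h4
        have := hSG k h g h3 h4
        rw [Sym2.eq_swap, Sym2.eq_swap (a := k), mul_comm h g] at this
        exact hs this
      simp only [← contractionOfChar_ne_zero_iff γ] at hs hs'
      grind
  · intro γ _ δ _ hγδ
    refine ZS.hom_ext fun p hp => ?_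
    induction p using Sym2.ind with
    | _ g h =>
      have := congrFun₂ hγδ g h
      rw [contractionOfChar_of_mem γ hp, contractionOfChar_of_mem δ hp] at this
      exact Additive.toMul.injective (Units.ext this)
  · rintro ε ⟨hsymm, hassoc, hsupp⟩
    let e : Sym2 G → F := Sym2.lift ⟨ε, hsymm⟩
    have he : ∀ p ∈ S, e p ≠ 0 := by
      intro p hp
      induction p using Sym2.ind with
      | _ g h => exact (hsupp g h).2 hp
    let u : Sym2 G → Additive Fˣ := fun p =>
      if hp : p ∈ S then Additive.ofMul (Units.mk0 (e p) (he p hp)) else 0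
    have hu {p : Sym2 G} (hp : p ∈ S) : ((u p).toMul : F) = e p := by
      simp [u, hp]
    have hrel : ∀ g h k : G, s(g, h) ∈ S → s(g * h, k) ∈ S → s(h, k) ∈ S →
        s(g, h * k) ∈ S → u s(g, h) + u s(g * h, k) = u s(h, k) + u s(g, h * k) := by
      intro g h k h1 h2 h3 h4
      apply Additive.toMul.injective
      apply Units.ext
      rw [toMul_add, toMul_add, Units.val_mul, Units.val_mul, hu h1, hu h2, hu h3, hu h4]
      have := hassoc g h k
      rw [hsymm k] at this
      exact (mul_comm _ _).trans (this.symm.trans (mul_comm _ _))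
    let γ : ZS S →+ Additive Fˣ := QuotientAddGroup.lift _
      ((FreeAbelianGroup.lift u).comp (FS S).subtype)
      fun x hx => lift_eq_zero_of_mem_RS hSG hrel (AddSubgroup.mem_addSubgroupOf.1 hx)
    refine ⟨γ, Set.mem_univ _, ?_⟩
    funext g h
    by_cases hs : s(g, h) ∈ S
    · rw [contractionOfChar_of_mem γ hs]
      have : γ (ZS.mkOf _ hs) = u s(g, h) := lift_apply_of u _
      rw [this, hu hs]
      rfl
    · rw [contractionOfChar_of_notMem γ hs]
      exact (not_not.1 (mt (hsupp g h).1 hs)).symm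
end
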